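/- arXiv:0907.5338 — 4 statements merged into one kernel-verified Lean document; each statement's English description precedes it below -/
import Mathlib

section
/- Let h : (0,∞) → ℝ be operator convex, let λ ∈ [0,1], and let L, R, L₁, R₁, L₂, R₂ be n×n positive definite complex Hermitian matrices such that the commutators [L,R] = [L₁,R₁] = [L₂,R₂] = 0 and L = λL₁ + (1−λ)L₂, R = λR₁ + (1−λ)R₂. Then h(L·R⁻¹)·R ≤ λ·h(L₁·R₁⁻¹)·R₁ + (1−λ)·h(L₂·R₂⁻¹)·R₂ in the Loewner order (each matrix h(LᵢRᵢ⁻¹)·Rᵢ is Hermitian since Lᵢ and Rᵢ commute). -/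
open Matrix Kronecker ComplexOrder

/-- Functional calculus: apply `g : ℝ → ℝ` to a Hermitian matrix via its spectral
decomposition (junk value `0` on non-Hermitian matrices). -/
noncomputable def matFun {ι : Type} [Fintype ι] [DecidableEq ι] (g : ℝ → ℝ)
    (M : Matrix ι ι ℂ) : Matrix ι ι ℂ :=
  if hM : M.IsHermitian then
    ∑ i, (g (hM.eigenvalues i) : ℂ) •
      Matrix.vecMulVec (⇑(hM.eigenvectorBasis i)) (star ⇑(hM.eigenvectorBasis i))
  else 0

/-- Operator monotonicity on `(0,∞)`: monotone w.r.t. the Loewner order on positive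
definite complex Hermitian matrices of all sizes. -/
def OperatorMonotone (g : ℝ → ℝ) : Prop :=
  ∀ (k : ℕ) (A B : Matrix (Fin k) (Fin k) ℂ), A.PosDef → B.PosDef →
    (B - A).PosSemidef → (matFun g B - matFun g A).PosSemidef

/-- Operator convexity on `(0,∞)` for positive definite complex Hermitian matrices
of all sizes. -/
def OperatorConvex (g : ℝ → ℝ) : Prop :=
  ∀ (k : ℕ) (A B : Matrix (Fin k) (Fin k) ℂ), A.PosDef → B.PosDef →
    ∀ t : ℝ, 0 ≤ t → t ≤ 1 →
      (t • matFun g A + (1 - t) • matFun g B - matFun g (t • A + (1 - t) • B)).PosSemidef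

theorem matFun_eq_cfc {ι : Type} [Fintype ι] [DecidableEq ι] (g : ℝ → ℝ) (M : Matrix ι ι ℂ) :
    matFun g M = cfc g M := by
  by_cases hM : M.IsHermitian
  · rw [hM.cfc_eq, matFun, dif_pos hM, Matrix.IsHermitian.cfc, Unitary.conjStarAlgAut_apply]
    ext i j
    simp [Matrix.sum_apply, Matrix.mul_apply, Matrix.diagonal_apply, Matrix.vecMulVec_apply,
      Matrix.star_apply, Matrix.IsHermitian.eigenvectorUnitary_apply]
    refine Finset.sum_congr rfl fun x _ => by ring
  · rw [matFun, dif_neg hM, cfc_apply_of_not_predicate]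
    exact hM

theorem matFun_isHermitian {ι : Type} [Fintype ι] [DecidableEq ι] (g : ℝ → ℝ)
    (M : Matrix ι ι ℂ) : (matFun g M).IsHermitian := by
  rw [matFun_eq_cfc]
  exact cfc_predicate g M

theorem aeval_mul_eq_mul_aeval {m k : Type} [Fintype m] [DecidableEq m] [Fintype k]
    [DecidableEq k] {X : Matrix m m ℂ} {Y : Matrix k k ℂ} {W : Matrix m k ℂ}
    (hW : X * W = W * Y) (p : Polynomial ℝ) :
    Polynomial.aeval X p * W = W * Polynomial.aeval Y p := by
  induction p using Polynomial.induction_on' with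
  | add p q hp hq => simp only [map_add, Matrix.add_mul, Matrix.mul_add, hp, hq]
  | monomial d a =>
    have hpow : X ^ d * W = W * Y ^ d := by
      induction d with
      | zero => simp
      | succ d ih => rw [pow_succ, Matrix.mul_assoc, hW, ← Matrix.mul_assoc, ih, Matrix.mul_assoc,
          ← pow_succ]
    simp only [Polynomial.aeval_monomial, Algebra.algebraMap_eq_smul_one, smul_one_mul,
      Matrix.smul_mul, Matrix.mul_smul, hpow]

/-- The functional calculus preserves intertwining relations. -/
theorem matFun_mul_eq_mul_matFun {m k : Type} [Fintype m] [DecidableEq m] [Fintype k]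
    [DecidableEq k] {X : Matrix m m ℂ} {Y : Matrix k k ℂ} {W : Matrix m k ℂ}
    (hX : X.IsHermitian) (hY : Y.IsHermitian) (hW : X * W = W * Y) (g : ℝ → ℝ) :
    matFun g X * W = W * matFun g Y := by
  classical
  set s : Finset ℝ := X.finite_real_spectrum.toFinset ∪ Y.finite_real_spectrum.toFinset
  set p : Polynomial ℝ := Lagrange.interpolate s id g
  have hp : ∀ x ∈ s, g x = p.eval x := fun x hx =>
    (Lagrange.eval_interpolate_at_node g (v := id) (Set.injOn_id _) hx).symm
  have hXp : matFun g X = Polynomial.aeval X p := by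
    rw [matFun_eq_cfc, ← cfc_polynomial p X hX]
    exact cfc_congr fun x hx => hp x (by simp [s, hx])
  have hYp : matFun g Y = Polynomial.aeval Y p := by
    rw [matFun_eq_cfc, ← cfc_polynomial p Y hY]
    exact cfc_congr fun x hx => hp x (by simp [s, hx])
  rw [hXp, hYp, aeval_mul_eq_mul_aeval hW]

theorem matFun_submatrix {m k : Type} [Fintype m] [DecidableEq m] [Fintype k] [DecidableEq k]
    (e : k ≃ m) {M : Matrix m m ℂ} (hM : M.IsHermitian) (g : ℝ → ℝ) :
    matFun g (M.submatrix e e) = (matFun g M).submatrix e e := by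
  have hP : M.submatrix e e * (1 : Matrix m m ℂ).submatrix e id
      = (1 : Matrix m m ℂ).submatrix e id * M := by
    rw [submatrix_mul_equiv, Matrix.mul_one]
    ext i j
    simp [Matrix.mul_apply, Matrix.one_apply]
  have h := matFun_mul_eq_mul_matFun (hM.submatrix e) hM hP g
  ext i j
  simpa [Matrix.mul_apply, Matrix.one_apply, ← e.symm_apply_eq] using congrFun (congrFun h i) (e j)

theorem OperatorConvex.posSemidef {g : ℝ → ℝ} (hg : OperatorConvex g) {ι : Type} [Fintype ι]
    [DecidableEq ι] {A B : Matrix ι ι ℂ} (hA : A.PosDef) (hB : B.PosDef) {t : ℝ} (ht0 : 0 ≤ t)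
    (ht1 : t ≤ 1) :
    (t • matFun g A + (1 - t) • matFun g B - matFun g (t • A + (1 - t) • B)).PosSemidef := by
  let e := (Fintype.equivFin ι).symm
  have hAB : (t • A + (1 - t) • B).IsHermitian :=
    (hA.isHermitian.smul (IsSelfAdjoint.all t)).add (hB.isHermitian.smul (IsSelfAdjoint.all _))
  have h := (hg _ _ _ (hA.submatrix e.injective) (hB.submatrix e.injective) t ht0 ht1).submatrix
    e.symm
  rw [matFun_submatrix e hA.isHermitian, matFun_submatrix e hB.isHermitian,
    show t • A.submatrix e e + (1 - t) • B.submatrix e e = (t • A + (1 - t) • B).submatrix e e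
      from rfl, matFun_submatrix e hAB] at h
  convert h using 1
  ext i j
  simp

theorem exists_unitary_extending_isometry {m k : Type} [Fintype m] [DecidableEq m] [Fintype k]
    [DecidableEq k] {C : Matrix (m ⊕ k) m ℂ} (hC : Cᴴ * C = 1) :
    ∃ U : Matrix (m ⊕ k) (m ⊕ k) ℂ, Uᴴ * U = 1 ∧
      U * (fromRows 1 0 : Matrix (m ⊕ k) m ℂ) = C := by
  let v : m ⊕ k → EuclideanSpace ℂ (m ⊕ k) :=
    Sum.elim (fun j => WithLp.toLp 2 fun i => C i j) 0
  have hv : Orthonormal ℂ ((Set.range Sum.inl).domRestrict v) := by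
    rw [orthonormal_iff_ite]
    rintro ⟨_, i, rfl⟩ ⟨_, j, rfl⟩
    have h := congrFun (congrFun hC i) j
    refine Eq.trans ?_ (if_congr (Subtype.ext_iff.trans Sum.inl_injective.eq_iff).symm rfl rfl)
    simpa [v, Matrix.mul_apply, PiLp.inner_apply, Matrix.one_apply, mul_comm] using h
  obtain ⟨b, hb⟩ := hv.exists_orthonormalBasis_extension_of_card_eq (by simp)
  refine ⟨Matrix.of fun i j => b j i, ?_, ?_⟩
  · ext i j
    have h := orthonormal_iff_ite.mp b.orthonormal i j
    simpa [Matrix.mul_apply, PiLp.inner_apply, Matrix.one_apply, mul_comm] using h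
  · ext i j
    simp [Matrix.mul_apply, Matrix.one_apply, hb (Sum.inl j) ⟨j, rfl⟩, v]

/-- Jensen's operator inequality for compressions to the range of an isometry. -/
theorem OperatorConvex.posSemidef_isometry {g : ℝ → ℝ} (hg : OperatorConvex g) {m k : Type}
    [Fintype m] [DecidableEq m] [Fintype k] [DecidableEq k] {A : Matrix (m ⊕ k) (m ⊕ k) ℂ}
    (hA : A.PosDef) {C : Matrix (m ⊕ k) m ℂ} (hC : Cᴴ * C = 1) :
    (Cᴴ * matFun g A * C - matFun g (Cᴴ * A * C)).PosSemidef := by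
  obtain ⟨U, hU, hUC⟩ := exists_unitary_extending_isometry hC
  have hU' : U * Uᴴ = 1 := mul_eq_one_comm.mp hU
  set E : Matrix (m ⊕ k) m ℂ := fromRows 1 0
  have hE : Eᴴ * E = 1 := by
    simp [E, conjTranspose_fromRows_eq_fromCols_conjTranspose, fromCols_mul_fromRows]
  set V : Matrix (m ⊕ k) (m ⊕ k) ℂ := fromBlocks 1 0 0 (-1)
  have hV : Vᴴ = V := by simp [V, fromBlocks_conjTranspose]
  have hVV : V * V = 1 := by simp [V, fromBlocks_multiply]
  have hVE : V * E = E := by simp [V, E, fromBlocks_mul_fromRows]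
  have hEV : Eᴴ * V = Eᴴ := by rw [← hV, ← conjTranspose_mul, hVE]
  have hEE : (1 / 2 : ℝ) • (1 + V) = E * Eᴴ := by
    rw [conjTranspose_fromRows_eq_fromCols_conjTranspose, fromRows_mul_fromCols]
    ext (i | i) (j | j) <;> simp [V, Matrix.one_apply]
    split_ifs <;> norm_num
  set M := Uᴴ * A * U
  have hM : M.PosDef := hA.conjTranspose_mul_mul_same
    (Matrix.mulVec_injective_of_isUnit (IsUnit.of_mul_eq_one _ hU'))
  have hM' : (V * M * V).PosDef := by
    have := hM.conjTranspose_mul_mul_same (B := V)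
      (Matrix.mulVec_injective_of_isUnit (IsUnit.of_mul_eq_one _ hVV))
    rwa [hV] at this
  have hgM : matFun g M = Uᴴ * matFun g A * U := by
    have h := matFun_mul_eq_mul_matFun hA.isHermitian hM.isHermitian
      (W := U) (by simp only [M, ← Matrix.mul_assoc, hU', Matrix.one_mul]) g
    rw [Matrix.mul_assoc, h, ← Matrix.mul_assoc, hU, Matrix.one_mul]
  have hgM' : matFun g (V * M * V) = V * matFun g M * V := by
    have h := matFun_mul_eq_mul_matFun hM'.isHermitian hM.isHermitian
      (W := V) (by rw [Matrix.mul_assoc, hVV, Matrix.mul_one]) g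
    rw [← h, Matrix.mul_assoc (matFun _ _), hVV, Matrix.mul_one]
  set X := Cᴴ * A * C
  have hX : X = Eᴴ * M * E := by
    simp only [X, M, ← hUC, conjTranspose_mul, Matrix.mul_assoc]
  set N := (1 / 2 : ℝ) • M + (1 - 1 / 2 : ℝ) • (V * M * V)
  have hN : N.IsHermitian :=
    (hM.isHermitian.smul (IsSelfAdjoint.all _)).add (hM'.isHermitian.smul (IsSelfAdjoint.all _))
  have hNE : N * E = E * X := by
    rw [hX, ← Matrix.mul_assoc, ← Matrix.mul_assoc, ← hEE]
    simp only [N, Matrix.add_mul, Matrix.smul_mul, Matrix.mul_assoc, hVE, Matrix.one_mul, smul_add]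
    norm_num
  have hgN : Eᴴ * matFun g N * E = matFun g X := by
    rw [Matrix.mul_assoc, matFun_mul_eq_mul_matFun hN
      (isHermitian_conjTranspose_mul_mul C hA.isHermitian) hNE, ← Matrix.mul_assoc, hE,
      Matrix.one_mul]
  have hEM : Eᴴ * matFun g M * E = Cᴴ * matFun g A * C := by
    simp only [hgM, ← hUC, conjTranspose_mul, Matrix.mul_assoc]
  have key := (hg.posSemidef hM hM' (t := 1 / 2) (by norm_num) (by norm_num))
    |>.conjTranspose_mul_mul_same E
  have hEVM : Eᴴ * (V * matFun g M * V) * E = Eᴴ * matFun g M * E := by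
    rw [← Matrix.mul_assoc, ← Matrix.mul_assoc, hEV, Matrix.mul_assoc, hVE]
  rw [Matrix.mul_sub, Matrix.sub_mul, hgN, Matrix.mul_add, Matrix.add_mul, Matrix.mul_smul,
    Matrix.smul_mul, Matrix.mul_smul, Matrix.smul_mul, hgM', hEVM, ← add_smul, hEM] at key
  simpa using key

theorem OperatorConvex.posSemidef_jensen {g : ℝ → ℝ} (hg : OperatorConvex g) {m : Type}
    [Fintype m] [DecidableEq m] {A₁ A₂ C₁ C₂ : Matrix m m ℂ} (hA₁ : A₁.PosDef) (hA₂ : A₂.PosDef)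
    (hC : C₁ᴴ * C₁ + C₂ᴴ * C₂ = 1) :
    (C₁ᴴ * matFun g A₁ * C₁ + C₂ᴴ * matFun g A₂ * C₂
      - matFun g (C₁ᴴ * A₁ * C₁ + C₂ᴴ * A₂ * C₂)).PosSemidef := by
  have hA : (fromBlocks A₁ 0 0 A₂).PosDef := by
    let := hA₁.isUnit.invertible
    have hpsd : (fromBlocks A₁ 0 0 A₂).PosSemidef := by
      simpa using (hA₁.fromBlocks₁₁ 0 A₂).mpr (by simpa using hA₂.posSemidef)
    rw [hpsd.posDef_iff_isUnit, Matrix.isUnit_iff_isUnit_det, det_fromBlocks_zero₁₂]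
    exact ((Matrix.isUnit_iff_isUnit_det _).mp hA₁.isUnit).mul
      ((Matrix.isUnit_iff_isUnit_det _).mp hA₂.isUnit)
  have h₁ := matFun_mul_eq_mul_matFun hA.isHermitian hA₁.isHermitian
    (W := (fromRows 1 0 : Matrix (m ⊕ m) m ℂ)) (by simp [fromBlocks_mul_fromRows, fromRows_mul]) g
  have h₂ := matFun_mul_eq_mul_matFun hA.isHermitian hA₂.isHermitian
    (W := (fromRows 0 1 : Matrix (m ⊕ m) m ℂ)) (by simp [fromBlocks_mul_fromRows, fromRows_mul]) g
  have hgA : matFun g (fromBlocks A₁ 0 0 A₂) * fromRows C₁ C₂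
      = fromRows (matFun g A₁ * C₁) (matFun g A₂ * C₂) := by
    have hsplit : fromRows C₁ C₂ = (fromRows 1 0 : Matrix (m ⊕ m) m ℂ) * C₁
        + (fromRows 0 1 : Matrix (m ⊕ m) m ℂ) * C₂ := by
      ext (i | i) j <;> simp [fromRows_mul]
    rw [hsplit, Matrix.mul_add, ← Matrix.mul_assoc, h₁, ← Matrix.mul_assoc, h₂]
    ext (i | i) j <;> simp [fromRows_mul]
  have h := hg.posSemidef_isometry hA (C := fromRows C₁ C₂)
    (by simpa [conjTranspose_fromRows_eq_fromCols_conjTranspose, fromCols_mul_fromRows] using hC)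
  rw [Matrix.mul_assoc, hgA] at h
  simpa [conjTranspose_fromRows_eq_fromCols_conjTranspose, fromCols_mul_fromRows,
    fromBlocks_mul_fromRows, Matrix.mul_assoc] using h

theorem matFun_sqrt_mul_self {ι : Type} [Fintype ι] [DecidableEq ι] {R : Matrix ι ι ℂ}
    (hR : R.PosSemidef) : matFun Real.sqrt R * matFun Real.sqrt R = R := by
  rw [matFun_eq_cfc, ← cfc_mul Real.sqrt Real.sqrt R]
  conv_rhs => rw [← cfc_id ℝ R hR.isHermitian]
  refine cfc_congr fun x hx => ?_
  rw [hR.isHermitian.spectrum_real_eq_range_eigenvalues] at hx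
  obtain ⟨i, rfl⟩ := hx
  exact Real.mul_self_sqrt (hR.eigenvalues_nonneg i)

/-- The quotient of commuting positive definite matrices, seen through the square root of the
denominator. -/
theorem exists_sqrt_of_commute {ι : Type} [Fintype ι] [DecidableEq ι] {L R : Matrix ι ι ℂ}
    (hL : L.PosDef) (hR : R.PosDef) (hcomm : L * R = R * L) :
    ∃ S : Matrix ι ι ℂ, Sᴴ = S ∧ IsUnit S.det ∧ S * S = R ∧ (L * R⁻¹).PosDef ∧
      S * (L * R⁻¹) * S = L ∧ ∀ g : ℝ → ℝ, S * matFun g (L * R⁻¹) * S = matFun g (L * R⁻¹) * R := by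
  set S := matFun Real.sqrt R
  have hS : Sᴴ = S := matFun_isHermitian _ _
  have hSS : S * S = R := matFun_sqrt_mul_self hR.posSemidef
  have hRdet : IsUnit R.det := (Matrix.isUnit_iff_isUnit_det R).mp hR.isUnit
  have hdet : IsUnit S.det := by
    rw [← hSS, det_mul] at hRdet
    exact isUnit_of_mul_isUnit_left hRdet
  have hSL : S * L = L * S := matFun_mul_eq_mul_matFun hR.isHermitian hR.isHermitian hcomm.symm _
  have hSinv : S⁻¹ * L = L * S⁻¹ := by
    calc S⁻¹ * L = S⁻¹ * (L * S) * S⁻¹ := by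
          rw [← Matrix.mul_assoc, Matrix.mul_nonsing_inv_cancel_right S _ hdet]
      _ = L * S⁻¹ := by rw [← hSL, Matrix.nonsing_inv_mul_cancel_left S _ hdet]
  have hA : L * R⁻¹ = S⁻¹ * L * S⁻¹ := by
    rw [← hSS, Matrix.mul_inv_rev, hSinv, Matrix.mul_assoc]
  have hApos : (L * R⁻¹).PosDef := by
    have h := hL.conjTranspose_mul_mul_same (B := S⁻¹) (Matrix.mulVec_injective_of_isUnit
      ((Matrix.isUnit_nonsing_inv_iff).mpr ((Matrix.isUnit_iff_isUnit_det S).mpr hdet)))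
    rwa [conjTranspose_nonsing_inv, hS, ← hA] at h
  have hAS : L * R⁻¹ * S = S * (L * R⁻¹) := by
    rw [hA, Matrix.mul_assoc, Matrix.nonsing_inv_mul _ hdet, Matrix.mul_one, Matrix.mul_assoc,
      Matrix.mul_nonsing_inv_cancel_left S _ hdet, hSinv]
  refine ⟨S, hS, hdet, hSS, hApos, ?_, fun g => ?_⟩
  · rw [hA, Matrix.mul_assoc, Matrix.mul_assoc, Matrix.nonsing_inv_mul _ hdet, Matrix.mul_one,
      Matrix.mul_nonsing_inv_cancel_left S _ hdet]
  · rw [← matFun_mul_eq_mul_matFun hApos.isHermitian hApos.isHermitian hAS, Matrix.mul_assoc, hSS]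

/-- **Effros's theorem.** If `h` is operator convex then, restricted to commuting
positive definite matrices, `g(L,R) = h(L·R⁻¹)·R` is jointly convex. -/
theorem effros_jointly_convex {n : ℕ} (h : ℝ → ℝ) (hconv : OperatorConvex h)
    (t : ℝ) (ht0 : 0 ≤ t) (ht1 : t ≤ 1)
    (L R L₁ R₁ L₂ R₂ : Matrix (Fin n) (Fin n) ℂ)
    (hL : L.PosDef) (hR : R.PosDef) (hL₁ : L₁.PosDef) (hR₁ : R₁.PosDef)
    (hL₂ : L₂.PosDef) (hR₂ : R₂.PosDef)
    (hcomm : L * R = R * L) (hcomm₁ : L₁ * R₁ = R₁ * L₁) (hcomm₂ : L₂ * R₂ = R₂ * L₂)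
    (hLsum : L = t • L₁ + (1 - t) • L₂) (hRsum : R = t • R₁ + (1 - t) • R₂) :
    (t • (matFun h (L₁ * R₁⁻¹) * R₁) + (1 - t) • (matFun h (L₂ * R₂⁻¹) * R₂)
      - matFun h (L * R⁻¹) * R).PosSemidef := by
  obtain ⟨S, hS, hdet, hSS, hA, hSAS, hg⟩ := exists_sqrt_of_commute hL hR hcomm
  obtain ⟨S₁, hS₁, -, hSS₁, hA₁, hSAS₁, hg₁⟩ := exists_sqrt_of_commute hL₁ hR₁ hcomm₁
  obtain ⟨S₂, hS₂, -, hSS₂, hA₂, hSAS₂, hg₂⟩ := exists_sqrt_of_commute hL₂ hR₂ hcomm₂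
  have hSinv : (S⁻¹)ᴴ = S⁻¹ := by rw [conjTranspose_nonsing_inv, hS]
  have hconj : ∀ (r : ℝ) (T X : Matrix (Fin n) (Fin n) ℂ), 0 ≤ r → Tᴴ = T →
      (√r • (T * S⁻¹))ᴴ * X * (√r • (T * S⁻¹)) = S⁻¹ * (r • (T * X * T)) * S⁻¹ := by
    intro r T X hr hT
    rw [conjTranspose_smul, conjTranspose_mul, hT, hSinv, Matrix.smul_mul, Matrix.smul_mul,
      Matrix.mul_smul, smul_smul, star_trivial, Real.mul_self_sqrt hr]
    simp only [Matrix.mul_smul, Matrix.smul_mul, Matrix.mul_assoc]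
  have ht1' : 0 ≤ 1 - t := sub_nonneg.mpr ht1
  have hcancel : ∀ X : Matrix (Fin n) (Fin n) ℂ, S⁻¹ * (S * X * S) * S⁻¹ = X := fun X => by
    rw [Matrix.mul_assoc S, Matrix.nonsing_inv_mul_cancel_left S _ hdet,
      Matrix.mul_nonsing_inv_cancel_right S _ hdet]
  have hcancel' : ∀ X : Matrix (Fin n) (Fin n) ℂ, S * (S⁻¹ * X * S⁻¹) * S = X := fun X => by
    rw [Matrix.mul_assoc S⁻¹, Matrix.mul_nonsing_inv_cancel_left S _ hdet,
      Matrix.nonsing_inv_mul_cancel_right S _ hdet]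
  have key := hconv.posSemidef_jensen (C₁ := √t • (S₁ * S⁻¹)) (C₂ := √(1 - t) • (S₂ * S⁻¹))
    hA₁ hA₂ (by
      have h₁ := hconj t S₁ 1 ht0 hS₁
      have h₂ := hconj (1 - t) S₂ 1 ht1' hS₂
      have h := hcancel 1
      rw [Matrix.mul_one] at h₁ h₂ h
      rw [Matrix.mul_one] at h₁ h₂
      rw [h₁, h₂, ← Matrix.add_mul, ← Matrix.mul_add, hSS₁, hSS₂, ← hRsum, ← hSS, h])
  rw [hconj t S₁ _ ht0 hS₁, hconj t S₁ _ ht0 hS₁, hconj _ S₂ _ ht1' hS₂, hconj _ S₂ _ ht1' hS₂,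
    hSAS₁, hSAS₂, hg₁, hg₂, ← Matrix.add_mul, ← Matrix.mul_add, ← Matrix.add_mul,
    ← Matrix.mul_add, ← hLsum] at key
  have hLR : S⁻¹ * L * S⁻¹ = L * R⁻¹ := by
    conv_lhs => rw [← hSAS]
    exact hcancel _
  have h := key.conjTranspose_mul_mul_same S
  rwa [hS, hLR, Matrix.mul_sub, Matrix.sub_mul, hg, hcancel'] at h
end

section
/- Let f : (0,∞) → (0,∞) be operator monotone. Then the function h₁(t) = t²/f(t), defined for t > 0, is operator convex. -/
open Matrix Kronecker ComplexOrder

section Diagonalization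

variable {ι κ l m : Type} [Fintype ι] [DecidableEq ι] [Fintype κ] [DecidableEq κ]
  [Fintype l] [DecidableEq l] [Fintype m] [DecidableEq m]

/-- `M = W diag(d) Wᴴ` with `W` unitary, where the eigenvalues `d` may be indexed by a type other
than the index type of `M`. -/
structure IsDiagonalizedBy (W : Matrix ι κ ℂ) (d : κ → ℝ) (M : Matrix ι ι ℂ) : Prop where
  conjTranspose_mul_self : Wᴴ * W = 1
  mul_conjTranspose_self : W * Wᴴ = 1
  eq_conj : M = W * diagonal (fun j => (d j : ℂ)) * Wᴴ

lemma Matrix.IsHermitian.isDiagonalizedBy {M : Matrix ι ι ℂ} (hM : M.IsHermitian) :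
    IsDiagonalizedBy (hM.eigenvectorUnitary : Matrix ι ι ℂ) hM.eigenvalues M where
  conjTranspose_mul_self := Unitary.coe_star_mul_self hM.eigenvectorUnitary
  mul_conjTranspose_self := Unitary.coe_mul_star_self hM.eigenvectorUnitary
  eq_conj := by
    conv_lhs => rw [hM.spectral_theorem]
    rfl

namespace IsDiagonalizedBy

variable {W : Matrix ι κ ℂ} {d : κ → ℝ} {M : Matrix ι ι ℂ}

lemma isHermitian (h : IsDiagonalizedBy W d M) : M.IsHermitian := by
  rw [h.eq_conj]
  refine isHermitian_mul_mul_conjTranspose _ (isHermitian_diagonal_of_self_adjoint _ ?_)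
  ext j
  simp

lemma intertwine (h : IsDiagonalizedBy W d M) {W' : Matrix ι l ℂ} {d' : l → ℝ}
    (h' : IsDiagonalizedBy W' d' M) (g : ℝ → ℝ) :
    W * diagonal (fun j => (g (d j) : ℂ)) * Wᴴ = W' * diagonal (fun j => (g (d' j) : ℂ)) * W'ᴴ := by
  have key : (W'ᴴ * W) * diagonal (fun j => (d j : ℂ))
      = diagonal (fun j => (d' j : ℂ)) * (W'ᴴ * W) := by
    have e := h.eq_conj.symm.trans h'.eq_conj
    calc (W'ᴴ * W) * diagonal (fun j => (d j : ℂ))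
        = W'ᴴ * (W * diagonal (fun j => (d j : ℂ)) * Wᴴ) * W := by
          simp only [Matrix.mul_assoc, h.conjTranspose_mul_self, Matrix.mul_one]
      _ = (W'ᴴ * W') * diagonal (fun j => (d' j : ℂ)) * (W'ᴴ * W) := by
          rw [e]; simp only [Matrix.mul_assoc]
      _ = _ := by rw [h'.conjTranspose_mul_self, Matrix.one_mul]
  have key' : (W'ᴴ * W) * diagonal (fun j => (g (d j) : ℂ))
      = diagonal (fun j => (g (d' j) : ℂ)) * (W'ᴴ * W) := by
    ext i j
    have := congrFun (congrFun key i) j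
    rw [mul_diagonal, diagonal_mul] at this ⊢
    by_cases hd : d j = d' i
    · rw [hd, mul_comm]
    · have : ((d j : ℂ) - d' i) * (W'ᴴ * W) i j = 0 := by linear_combination this
      rcases mul_eq_zero.1 this with h0 | h0
      · exact absurd (by exact_mod_cast sub_eq_zero.1 h0) hd
      · simp [h0]
  calc W * diagonal (fun j => (g (d j) : ℂ)) * Wᴴ
      = (W' * W'ᴴ) * W * diagonal (fun j => (g (d j) : ℂ)) * Wᴴ := by
        rw [h'.mul_conjTranspose_self, Matrix.one_mul]
    _ = W' * ((W'ᴴ * W) * diagonal (fun j => (g (d j) : ℂ))) * Wᴴ := by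
        simp only [Matrix.mul_assoc]
    _ = W' * diagonal (fun j => (g (d' j) : ℂ)) * W'ᴴ * (W * Wᴴ) := by
        rw [key']; simp only [Matrix.mul_assoc]
    _ = _ := by rw [h.mul_conjTranspose_self, Matrix.mul_one]

lemma matFun (h : IsDiagonalizedBy W d M) (g : ℝ → ℝ) :
    IsDiagonalizedBy W (fun j => g (d j)) (matFun g M) where
  conjTranspose_mul_self := h.conjTranspose_mul_self
  mul_conjTranspose_self := h.mul_conjTranspose_self
  eq_conj := by
    have hM := h.isHermitian
    rw [h.intertwine hM.isDiagonalizedBy g, _root_.matFun, dif_pos hM]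
    ext i j
    simp [Matrix.sum_apply, Matrix.mul_apply, vecMulVec_apply, diagonal_apply, mul_assoc,
      mul_left_comm]

lemma posDef (h : IsDiagonalizedBy W d M) (hd : ∀ j, 0 < d j) : M.PosDef := by
  rw [h.eq_conj]
  refine PosDef.mul_mul_conjTranspose_same (PosDef.diagonal fun j => ?_) ?_
  · exact_mod_cast hd j
  · intro x y hxy
    simpa [vecMul_vecMul, h.mul_conjTranspose_self] using congrArg (· ᵥ* Wᴴ) hxy

lemma posSemidef (h : IsDiagonalizedBy W d M) (hd : ∀ j, 0 ≤ d j) : M.PosSemidef := by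
  rw [h.eq_conj]
  refine PosSemidef.mul_mul_conjTranspose_same (PosSemidef.diagonal fun j => ?_) _
  exact Complex.zero_le_real.2 (hd j)

lemma pos_of_posDef (h : IsDiagonalizedBy W d M) (hM : M.PosDef) (j : κ) : 0 < d j := by
  have e : Wᴴ * M * W = diagonal (fun j => (d j : ℂ)) := by
    rw [h.eq_conj]
    calc _ = (Wᴴ * W) * diagonal (fun j => (d j : ℂ)) * (Wᴴ * W) := by simp only [Matrix.mul_assoc]
      _ = _ := by rw [h.conjTranspose_mul_self, Matrix.one_mul, Matrix.mul_one]
  have hpd : (Wᴴ * M * W).PosDef := by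
    refine hM.conjTranspose_mul_mul_same fun x y hxy => ?_
    simpa [h.conjTranspose_mul_self] using congrArg (Wᴴ *ᵥ ·) hxy
  rw [e, posDef_diagonal_iff] at hpd
  exact_mod_cast hpd j

lemma conj (h : IsDiagonalizedBy W d M) {V : Matrix l ι ℂ} (hV : Vᴴ * V = 1) (hV' : V * Vᴴ = 1) :
    IsDiagonalizedBy (V * W) d (V * M * Vᴴ) where
  conjTranspose_mul_self := by
    rw [conjTranspose_mul, Matrix.mul_assoc, ← Matrix.mul_assoc Vᴴ, hV, Matrix.one_mul,
      h.conjTranspose_mul_self]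
  mul_conjTranspose_self := by
    rw [conjTranspose_mul, Matrix.mul_assoc, ← Matrix.mul_assoc W, h.mul_conjTranspose_self,
      Matrix.one_mul, hV']
  eq_conj := by
    rw [h.eq_conj, conjTranspose_mul]
    simp only [Matrix.mul_assoc]

lemma fromBlocks (h : IsDiagonalizedBy W d M) {W' : Matrix l m ℂ} {d' : m → ℝ} {N : Matrix l l ℂ}
    (h' : IsDiagonalizedBy W' d' N) :
    IsDiagonalizedBy (fromBlocks W 0 0 W') (Sum.elim d d') (fromBlocks M 0 0 N) where
  conjTranspose_mul_self := by
    simp [fromBlocks_conjTranspose, fromBlocks_multiply, h.conjTranspose_mul_self,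
      h'.conjTranspose_mul_self]
  mul_conjTranspose_self := by
    simp [fromBlocks_conjTranspose, fromBlocks_multiply, h.mul_conjTranspose_self,
      h'.mul_conjTranspose_self]
  eq_conj := by
    have : (fun j => ((Sum.elim d d' j : ℝ) : ℂ))
        = Sum.elim (fun j => (d j : ℂ)) (fun j => (d' j : ℂ)) := by
      ext (j | j) <;> rfl
    rw [this, ← fromBlocks_diagonal, fromBlocks_conjTranspose, fromBlocks_multiply,
      fromBlocks_multiply]
    simp [← h.eq_conj, ← h'.eq_conj]

lemma add_smul_one (h : IsDiagonalizedBy W d M) (a : ℝ) :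
    IsDiagonalizedBy W (fun j => d j + a) (M + (a : ℂ) • 1) where
  conjTranspose_mul_self := h.conjTranspose_mul_self
  mul_conjTranspose_self := h.mul_conjTranspose_self
  eq_conj := by
    have : diagonal (fun j => ((d j + a : ℝ) : ℂ))
        = diagonal (fun j => (d j : ℂ)) + (a : ℂ) • (1 : Matrix κ κ ℂ) := by
      ext i j
      by_cases hij : i = j <;> simp [one_apply, hij]
    rw [this, Matrix.mul_add, Matrix.add_mul, ← h.eq_conj]
    simp [h.mul_conjTranspose_self]

lemma smul (h : IsDiagonalizedBy W d M) (a : ℝ) :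
    IsDiagonalizedBy W (fun j => a * d j) ((a : ℂ) • M) where
  conjTranspose_mul_self := h.conjTranspose_mul_self
  mul_conjTranspose_self := h.mul_conjTranspose_self
  eq_conj := by
    have : diagonal (fun j => ((a * d j : ℝ) : ℂ)) = (a : ℂ) • diagonal (fun j => (d j : ℂ)) := by
      ext i j
      by_cases hij : i = j <;> simp [hij]
    rw [this, Matrix.mul_smul, Matrix.smul_mul, ← h.eq_conj]

lemma sub {d' : κ → ℝ} {N : Matrix ι ι ℂ} (h : IsDiagonalizedBy W d M)
    (h' : IsDiagonalizedBy W d' N) : IsDiagonalizedBy W (fun j => d j - d' j) (M - N) where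
  conjTranspose_mul_self := h.conjTranspose_mul_self
  mul_conjTranspose_self := h.mul_conjTranspose_self
  eq_conj := by
    have : diagonal (fun j => ((d j - d' j : ℝ) : ℂ))
        = diagonal (fun j => (d j : ℂ)) - diagonal (fun j => (d' j : ℂ)) := by
      ext i j
      by_cases hij : i = j <;> simp [hij]
    rw [this, Matrix.mul_sub, Matrix.sub_mul, ← h.eq_conj, ← h'.eq_conj]

lemma mul {d' : κ → ℝ} {N : Matrix ι ι ℂ} (h : IsDiagonalizedBy W d M)
    (h' : IsDiagonalizedBy W d' N) : IsDiagonalizedBy W (fun j => d j * d' j) (M * N) where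
  conjTranspose_mul_self := h.conjTranspose_mul_self
  mul_conjTranspose_self := h.mul_conjTranspose_self
  eq_conj := by
    have : diagonal (fun j => ((d j * d' j : ℝ) : ℂ))
        = diagonal (fun j => (d j : ℂ)) * diagonal (fun j => (d' j : ℂ)) := by
      simp [diagonal_mul_diagonal]
    rw [this, h.eq_conj, h'.eq_conj]
    calc _ = W * diagonal (fun j => (d j : ℂ)) * (Wᴴ * W) * diagonal (fun j => (d' j : ℂ)) * Wᴴ := by
          simp only [Matrix.mul_assoc]
      _ = _ := by rw [h.conjTranspose_mul_self, Matrix.mul_one]; simp only [Matrix.mul_assoc]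

lemma unique {N : Matrix ι ι ℂ} (h : IsDiagonalizedBy W d M) (h' : IsDiagonalizedBy W d N) :
    M = N :=
  h.eq_conj.trans h'.eq_conj.symm

lemma smul_one (h : IsDiagonalizedBy W d M) (a : ℝ) :
    IsDiagonalizedBy W (fun _ => a) ((a : ℂ) • 1) where
  conjTranspose_mul_self := h.conjTranspose_mul_self
  mul_conjTranspose_self := h.mul_conjTranspose_self
  eq_conj := by
    have : diagonal (fun _ => (a : ℂ)) = (a : ℂ) • (1 : Matrix κ κ ℂ) := by
      simp [smul_one_eq_diagonal]
    rw [this, Matrix.mul_smul, Matrix.smul_mul, Matrix.mul_one, h.mul_conjTranspose_self]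

end IsDiagonalizedBy

lemma matFun_conj {M : Matrix ι ι ℂ} (hM : M.IsHermitian) {V : Matrix l ι ℂ} (hV : Vᴴ * V = 1)
    (hV' : V * Vᴴ = 1) (g : ℝ → ℝ) : matFun g (V * M * Vᴴ) = V * matFun g M * Vᴴ :=
  ((hM.isDiagonalizedBy.conj hV hV').matFun g).unique ((hM.isDiagonalizedBy.matFun g).conj hV hV')

lemma matFun_fromBlocks {M : Matrix ι ι ℂ} (hM : M.IsHermitian) {N : Matrix l l ℂ}
    (hN : N.IsHermitian) (g : ℝ → ℝ) :
    matFun g (fromBlocks M 0 0 N) = fromBlocks (matFun g M) 0 0 (matFun g N) := by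
  refine ((hM.isDiagonalizedBy.fromBlocks hN.isDiagonalizedBy).matFun g).unique ?_
  convert (hM.isDiagonalizedBy.matFun g).fromBlocks (hN.isDiagonalizedBy.matFun g) using 1
  ext (j | j) <;> rfl

lemma matFun_smul_one (g : ℝ → ℝ) (a : ℝ) :
    matFun g ((a : ℂ) • (1 : Matrix ι ι ℂ)) = (g a : ℂ) • 1 :=
  have h := (isHermitian_one (n := ι) (α := ℂ)).isDiagonalizedBy
  ((h.smul_one a).matFun g).unique (h.smul_one (g a))

lemma matFun_posDef {A : Matrix ι ι ℂ} (hA : A.PosDef) {g : ℝ → ℝ} (hg : ∀ t > 0, 0 < g t) :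
    (matFun g A).PosDef :=
  (hA.1.isDiagonalizedBy.matFun g).posDef fun j => hg _ (hA.1.isDiagonalizedBy.pos_of_posDef hA j)

lemma posDef_fromBlocks_zero {A : Matrix ι ι ℂ} {B : Matrix l l ℂ} (hA : A.PosDef)
    (hB : B.PosDef) : (fromBlocks A 0 0 B).PosDef := by
  refine (hA.1.isDiagonalizedBy.fromBlocks hB.1.isDiagonalizedBy).posDef ?_
  rintro (j | j)
  · exact hA.1.isDiagonalizedBy.pos_of_posDef hA j
  · exact hB.1.isDiagonalizedBy.pos_of_posDef hB j

lemma Matrix.IsHermitian.exists_smul_one_sub_posSemidef {H : Matrix ι ι ℂ} (hH : H.IsHermitian) :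
    ∃ r : ℝ, 0 < r ∧ ((r : ℂ) • 1 - H).PosSemidef := by
  have h := hH.isDiagonalizedBy
  refine ⟨1 + ∑ j, |hH.eigenvalues j|, by positivity, ((h.smul_one _).sub h).posSemidef fun j => ?_⟩
  have := Finset.single_le_sum (f := fun j => |hH.eigenvalues j|) (fun i _ => abs_nonneg _)
    (Finset.mem_univ j)
  have := le_abs_self (hH.eigenvalues j)
  linarith

omit [Fintype ι] in
lemma posDef_smul_one {a : ℝ} (ha : 0 < a) : ((a : ℂ) • (1 : Matrix ι ι ℂ)).PosDef :=
  PosDef.one.smul (Complex.zero_lt_real.2 ha)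

omit [Fintype ι] [DecidableEq ι] in
lemma posDef_convexCombination {A B : Matrix ι ι ℂ} (hA : A.PosDef) (hB : B.PosDef) {p q : ℝ}
    (hp : 0 ≤ p) (hq : 0 ≤ q) (hpq : p + q = 1) : ((p : ℂ) • A + (q : ℂ) • B).PosDef := by
  rcases hp.eq_or_lt with rfl | hp
  · obtain rfl : q = 1 := by linarith
    simpa using hB
  · exact (hA.smul (Complex.zero_lt_real.2 hp)).add_posSemidef
      (hB.posSemidef.smul (Complex.zero_le_real.2 hq))

/-- The inequality of an operator monotone function for matrices indexed by any finite type. -/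
lemma OperatorMonotone.posSemidef_sub {f : ℝ → ℝ} (hf : OperatorMonotone f) {A B : Matrix ι ι ℂ}
    (hA : A.PosDef) (hB : B.PosDef) (hAB : (B - A).PosSemidef) :
    (matFun f B - matFun f A).PosSemidef := by
  let e := Fintype.equivFin ι
  let P : Matrix (Fin (Fintype.card ι)) ι ℂ := (1 : Matrix ι ι ℂ).submatrix e.symm id
  have hconj (M : Matrix ι ι ℂ) : P * M * Pᴴ = M.submatrix e.symm e.symm := by
    ext i j
    simp [P, Matrix.mul_apply, one_apply]
  have hP' : P * Pᴴ = 1 := by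
    have := hconj 1
    rwa [Matrix.mul_one, submatrix_one_equiv] at this
  have hP : Pᴴ * P = 1 := by
    ext i j
    simp [P, Matrix.mul_apply, one_apply, ← Equiv.eq_symm_apply]
  have key := hf _ (A.submatrix e.symm e.symm) (B.submatrix e.symm e.symm)
    (hA.submatrix e.symm.injective) (hB.submatrix e.symm.injective) (hAB.submatrix e.symm)
  rw [← hconj, ← hconj, matFun_conj hA.1 hP hP', matFun_conj hB.1 hP hP', hconj, hconj] at key
  exact (posSemidef_submatrix_equiv e.symm).1 key

lemma OperatorMonotone.posSemidef_matFun_add_sub {f : ℝ → ℝ} (hf : OperatorMonotone f)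
    {A B : Matrix ι ι ℂ} (hA : A.PosDef) (hB : B.PosDef) {p q ε : ℝ}
    (hp : 0 ≤ p) (hq : 0 ≤ q) (hpq : p + q = 1) (hε : 0 < ε) :
    (matFun f (((p : ℂ) • A + (q : ℂ) • B) + (ε : ℂ) • 1)
      - ((p : ℂ) • matFun f A + (q : ℂ) • matFun f B)).PosSemidef := by
  obtain ⟨s, rfl⟩ : ∃ s : ℝ, p = s * s := ⟨√p, (Real.mul_self_sqrt hp).symm⟩
  obtain ⟨c, rfl⟩ : ∃ c : ℝ, q = c * c := ⟨√q, (Real.mul_self_sqrt hq).symm⟩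
  have hqp : c * c + s * s = 1 := by rw [add_comm, hpq]
  let V : Matrix (ι ⊕ ι) (ι ⊕ ι) ℂ :=
    fromBlocks ((s : ℂ) • 1) ((c : ℂ) • 1) (-(c : ℂ) • 1) ((s : ℂ) • 1)
  have hVconj : Vᴴ = fromBlocks ((s : ℂ) • 1) (-(c : ℂ) • 1) ((c : ℂ) • 1) ((s : ℂ) • 1) := by
    simp [V, fromBlocks_conjTranspose, conjTranspose_smul]
  have hV : Vᴴ * V = 1 := by
    rw [hVconj, fromBlocks_multiply, ← fromBlocks_one]
    simp [smul_smul, ← add_smul, hpq, hqp, mul_comm]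
  have hV' : V * Vᴴ = 1 := by
    rw [hVconj, fromBlocks_multiply, ← fromBlocks_one]
    simp [smul_smul, ← add_smul, hpq, hqp, mul_comm]
  have hconj (X Y : Matrix ι ι ℂ) : V * fromBlocks X 0 0 Y * Vᴴ =
      fromBlocks (((s * s : ℝ) : ℂ) • X + ((c * c : ℝ) : ℂ) • Y) (((s * c : ℝ) : ℂ) • (Y - X))
        (((s * c : ℝ) : ℂ) • (Y - X)) (((c * c : ℝ) : ℂ) • X + ((s * s : ℝ) : ℂ) • Y) := by
    rw [hVconj, fromBlocks_multiply, fromBlocks_multiply]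
    simp [smul_smul, mul_comm, sub_eq_add_neg, add_comm, -Complex.ofReal_mul]
  set D := ((s * c : ℝ) : ℂ) • (B - A) with hD
  set C := ((s * s : ℝ) : ℂ) • A + ((c * c : ℝ) : ℂ) • B with hC
  set E := ((c * c : ℝ) : ℂ) • A + ((s * s : ℝ) : ℂ) • B with hE
  have hDh : Dᴴ = D := by
    simp [hD, conjTranspose_smul, hA.1.eq, hB.1.eq]
  have hCp : C.PosDef := posDef_convexCombination hA hB hp hq hpq
  have hEp : E.PosDef := posDef_convexCombination hA hB hq hp hqp
  have hεp : ((ε : ℂ) • (1 : Matrix ι ι ℂ)).PosDef := posDef_smul_one hε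
  have hCε : (C + (ε : ℂ) • 1).PosDef := hCp.add hεp
  have hHerm : (E + (-D)ᴴ * ((ε : ℂ) • (1 : Matrix ι ι ℂ))⁻¹ * (-D)).IsHermitian :=
    hEp.1.add (isHermitian_conjTranspose_mul_mul _ hεp.inv.1)
  obtain ⟨r, hr, hrp⟩ := hHerm.exists_smul_one_sub_posSemidef
  have hT := posDef_fromBlocks_zero hA hB
  have hle : (fromBlocks (C + (ε : ℂ) • 1) 0 0 ((r : ℂ) • 1)
      - V * fromBlocks A 0 0 B * Vᴴ).PosSemidef := by
    rw [hconj, ← hC, ← hD, ← hE, sub_eq_add_neg, fromBlocks_neg, fromBlocks_add]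
    have : Invertible ((ε : ℂ) • (1 : Matrix ι ι ℂ)) := hεp.isUnit.invertible
    have := (hεp.fromBlocks₁₁ (-D) ((r : ℂ) • 1 - E)).2 (by rwa [sub_sub])
    rw [conjTranspose_neg, hDh] at this
    rwa [add_comm C, add_neg_cancel_right, zero_add, ← sub_eq_add_neg]
  have hVT : (V * fromBlocks A 0 0 B * Vᴴ).PosDef :=
    (hT.1.isDiagonalizedBy.conj hV hV').posDef (hT.1.isDiagonalizedBy.pos_of_posDef hT)
  have key := hf.posSemidef_sub hVT (posDef_fromBlocks_zero hCε (posDef_smul_one hr)) hle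
  rw [matFun_conj hT.1 hV hV', matFun_fromBlocks hA.1 hB.1, hconj,
    matFun_fromBlocks hCε.1 (posDef_smul_one hr).1] at key
  exact key.submatrix Sum.inl

/-- A quantitative form of right continuity. -/
lemma OperatorMonotone.mul_apply_add_le {f : ℝ → ℝ} (hf : OperatorMonotone f)
    (hpos : ∀ t > 0, 0 < f t) {x δ : ℝ} (hδ : 0 < δ) (hx : 2 * δ < x) :
    (1 - 2 * δ / x) * f (x + δ) ≤ f x := by
  have hx0 : 0 < x := by linarith
  have hp : 0 ≤ 2 * δ / x := by positivity
  have hq : 0 ≤ 1 - 2 * δ / x := by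
    rw [sub_nonneg, div_le_one hx0]; exact hx.le
  have key := hf.posSemidef_matFun_add_sub (ι := Unit) (posDef_smul_one (half_pos hx0))
    (posDef_smul_one (add_pos hx0 hδ)) hp hq (by ring) (show 0 < 2 * δ ^ 2 / x by positivity)
  have e : ((2 * δ / x : ℝ) : ℂ) * ((x / 2 : ℝ) : ℂ) + ((1 - 2 * δ / x : ℝ) : ℂ) * ((x + δ : ℝ) : ℂ)
      + ((2 * δ ^ 2 / x : ℝ) : ℂ) = (x : ℂ) := by
    norm_cast
    field_simp
    ring
  rw [smul_smul, smul_smul, ← add_smul, ← add_smul, e, matFun_smul_one, matFun_smul_one,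
    matFun_smul_one] at key
  have h0 := key.diag_nonneg (i := ())
  simp only [Matrix.sub_apply, Matrix.add_apply, Matrix.smul_apply, one_apply_eq, smul_eq_mul,
    mul_one] at h0
  have h1 : 0 ≤ f x - (2 * δ / x * f (x / 2) + (1 - 2 * δ / x) * f (x + δ)) := by exact_mod_cast h0
  have := mul_nonneg hp (hpos (x / 2) (by positivity)).le
  linarith

omit [DecidableEq ι] in
lemma posSemidef_of_forall_add_smul {N S : Matrix ι ι ℂ} (hN : N.IsHermitian) {a : ℝ} (ha : 0 < a)
    (h : ∀ δ : ℝ, 0 < δ → δ < a → (N + (δ : ℂ) • S).PosSemidef) : N.PosSemidef := by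
  refine .of_dotProduct_mulVec_nonneg hN fun x => ?_
  have hlim : Filter.Tendsto (fun δ : ℝ => star x ⬝ᵥ (N *ᵥ x) + (δ : ℂ) * (star x ⬝ᵥ (S *ᵥ x)))
      (nhdsWithin 0 (Set.Ioi 0)) (nhds (star x ⬝ᵥ (N *ᵥ x))) := by
    have : Continuous fun δ : ℝ => star x ⬝ᵥ (N *ᵥ x) + (δ : ℂ) * (star x ⬝ᵥ (S *ᵥ x)) := by
      fun_prop
    simpa using (this.tendsto 0).mono_left nhdsWithin_le_nhds
  refine ge_of_tendsto hlim ?_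
  filter_upwards [Ioo_mem_nhdsGT ha] with δ hδ
  simpa [add_mulVec, smul_mulVec] using (h δ hδ.1 hδ.2).dotProduct_mulVec_nonneg x

/-- Positive operator monotone functions on `(0, ∞)` are operator concave. -/
lemma OperatorMonotone.posSemidef_matFun_sub {f : ℝ → ℝ} (hf : OperatorMonotone f)
    (hpos : ∀ t > 0, 0 < f t) {A B : Matrix ι ι ℂ} (hA : A.PosDef) (hB : B.PosDef) {p q : ℝ}
    (hp : 0 ≤ p) (hq : 0 ≤ q) (hpq : p + q = 1) :
    (matFun f ((p : ℂ) • A + (q : ℂ) • B)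
      - ((p : ℂ) • matFun f A + (q : ℂ) • matFun f B)).PosSemidef := by
  have hC := posDef_convexCombination hA hB hp hq hpq
  have hS := posDef_convexCombination (matFun_posDef hA hpos) (matFun_posDef hB hpos) hp hq hpq
  have hdiag := hC.1.isDiagonalizedBy
  obtain ⟨m, hm, hle⟩ : ∃ m > 0, ∀ j, m ≤ hC.1.eigenvalues j := by
    rcases isEmpty_or_nonempty ι with h | h
    · exact ⟨1, one_pos, fun j => h.elim j⟩
    · obtain ⟨i, hi⟩ := Finite.exists_min hC.1.eigenvalues
      exact ⟨_, hdiag.pos_of_posDef hC i, hi⟩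
  refine posSemidef_of_forall_add_smul ((matFun_posDef hC hpos).1.sub hS.1) one_pos
    (S := (p : ℂ) • matFun f A + (q : ℂ) • matFun f B) fun δ hδ hδ1 => ?_
  have hε : 0 < δ * m / 2 := by positivity
  have h1 := hf.posSemidef_matFun_add_sub hA hB hp hq hpq hε
  have h2 := ((hdiag.matFun f).sub
    (((hdiag.add_smul_one (δ * m / 2)).matFun f).smul (1 - δ))).posSemidef fun j => by
      have hj := hle j
      have hj0 := hm.trans_le hj
      have hlt : 2 * (δ * m / 2) < hC.1.eigenvalues j := by nlinarith
      have h := hf.mul_apply_add_le hpos hε hlt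
      have : 2 * (δ * m / 2) / hC.1.eigenvalues j ≤ δ := by
        rw [div_le_iff₀ hj0]; nlinarith
      have := mul_le_mul_of_nonneg_right (sub_le_sub_left this 1) (hpos _ (add_pos hj0 hε)).le
      linarith
  convert h2.add (h1.smul (Complex.zero_le_real.2 (sub_nonneg.2 hδ1.le))) using 1
  simp only [Complex.ofReal_sub, Complex.ofReal_one]
  module

lemma matFun_sq_div {f : ℝ → ℝ} (hpos : ∀ t > 0, 0 < f t) {A : Matrix ι ι ℂ} (hA : A.PosDef) :
    matFun (fun t => t ^ 2 / f t) A = A * (matFun f A)⁻¹ * A := by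
  have h := hA.1.isDiagonalizedBy
  have hinv : (matFun f A)⁻¹ = matFun (fun t => (f t)⁻¹) A := by
    refine inv_eq_right_inv (((h.matFun f).mul (h.matFun _)).unique ?_)
    convert h.smul_one 1 using 1
    · ext j
      exact mul_inv_cancel₀ (hpos _ (h.pos_of_posDef hA j)).ne'
    · simp
  rw [hinv]
  refine (h.matFun _).unique ?_
  convert (h.mul (h.matFun fun t => (f t)⁻¹)).mul h using 1
  ext j
  ring

/-- The map `(X, F) ↦ Xᴴ F⁻¹ X` is jointly convex, and antitone in `F`. -/
lemma posSemidef_mul_inv_mul_sub {A B F G K : Matrix ι ι ℂ} (hF : F.PosDef) (hG : G.PosDef)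
    (hK : K.PosDef) {p q : ℝ} (hp : 0 ≤ p) (hq : 0 ≤ q)
    (h : (K - ((p : ℂ) • F + (q : ℂ) • G)).PosSemidef) :
    ((p : ℂ) • (Aᴴ * F⁻¹ * A) + (q : ℂ) • (Bᴴ * G⁻¹ * B)
      - ((p : ℂ) • A + (q : ℂ) • B)ᴴ * K⁻¹ * ((p : ℂ) • A + (q : ℂ) • B)).PosSemidef := by
  have hblock {X Y : Matrix ι ι ℂ} (hY : Y.PosDef) :
      (fromBlocks Y X Xᴴ (Xᴴ * Y⁻¹ * X)).PosSemidef := by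
    have : Invertible Y := hY.isUnit.invertible
    rw [hY.fromBlocks₁₁, sub_self]
    exact .zero
  have hdiff : (fromBlocks (K - ((p : ℂ) • F + (q : ℂ) • G)) 0 0 (0 : Matrix ι ι ℂ)).PosSemidef := by
    have := h.conjTranspose_mul_mul_same (fromCols (1 : Matrix ι ι ℂ) (0 : Matrix ι ι ℂ))
    rw [conjTranspose_fromCols_eq_fromRows_conjTranspose, fromRows_mul,
      fromRows_mul_fromCols] at this
    simpa using this
  have key := (((hblock (X := A) hF).smul (Complex.zero_le_real.2 hp)).add
    ((hblock (X := B) hG).smul (Complex.zero_le_real.2 hq))).add hdiff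
  have : Invertible K := hK.isUnit.invertible
  have e : fromBlocks K ((p : ℂ) • A + (q : ℂ) • B) ((p : ℂ) • A + (q : ℂ) • B)ᴴ
      ((p : ℂ) • (Aᴴ * F⁻¹ * A) + (q : ℂ) • (Bᴴ * G⁻¹ * B))
      = (p : ℂ) • fromBlocks F A Aᴴ (Aᴴ * F⁻¹ * A) + (q : ℂ) • fromBlocks G B Bᴴ (Bᴴ * G⁻¹ * B)
        + fromBlocks (K - ((p : ℂ) • F + (q : ℂ) • G)) 0 0 (0 : Matrix ι ι ℂ) := by
    simp [fromBlocks_smul, fromBlocks_add, conjTranspose_smul]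
  rw [← hK.fromBlocks₁₁, e]
  exact key

end Diagonalization

/-- If `f : (0,∞) → (0,∞)` is operator monotone, then `h₁(t) = t²/f(t)` is
operator convex on `(0,∞)`. -/
theorem operatorConvex_sq_div_of_operatorMonotone (f : ℝ → ℝ)
    (hf_pos : ∀ t > 0, 0 < f t) (hf_mono : OperatorMonotone f) :
    OperatorConvex (fun t => t ^ 2 / f t) := by
  intro k A B hA hB t ht0 ht1
  simp only [← Complex.coe_smul]
  have ht1' : 0 ≤ 1 - t := sub_nonneg.2 ht1
  have hC := posDef_convexCombination hA hB ht0 ht1' (by ring)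
  have key := posSemidef_mul_inv_mul_sub (A := A) (B := B) (matFun_posDef hA hf_pos)
    (matFun_posDef hB hf_pos) (matFun_posDef hC hf_pos) ht0 ht1'
    (hf_mono.posSemidef_matFun_sub hf_pos hA hB ht0 ht1' (by ring))
  rw [matFun_sq_div hf_pos hA, matFun_sq_div hf_pos hB, matFun_sq_div hf_pos hC]
  rwa [hA.1.eq, hB.1.eq, hC.1.eq] at key
end

section
/- Let f ∈ F_op with Morozova-Chentsov function c, and let A be a fixed n×n complex Hermitian matrix. Then the map ρ ↦ Σ_{k,l} ĉ(λ_k,λ_l)·|⟨u_k, A u_l⟩|² is convex on the set of n×n positive definite density matrices: for positive definite density matrices ρ, σ and λ ∈ [0,1], the value of this map at λρ + (1−λ)σ is at most λ times its value at ρ plus (1−λ) times its value at σ. In particular the metric adjusted skew information ρ ↦ I^c_ρ(A) is convex in the state variable. -/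
open Matrix Kronecker ComplexOrder

/-- `ĉ(x,y) = (x-y)² · c(x,y)` where `c(x,y) = 1/(y·f(x/y))` is the
Morozova-Chentsov function associated with `f`. -/
noncomputable def chat (f : ℝ → ℝ) (x y : ℝ) : ℝ :=
  (x - y) ^ 2 * (1 / (y * f (x / y)))

/-- The quadratic form `Σ_{k,l} ĉ(λ_k,λ_l)·|⟨u_k, A u_l⟩|²` computed from the spectral
decomposition of the Hermitian matrix `ρ` (junk value `0` on non-Hermitian matrices). -/
noncomputable def skewSum {ι : Type} [Fintype ι] [DecidableEq ι] (f : ℝ → ℝ)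
    (ρ A : Matrix ι ι ℂ) : ℝ :=
  if hρ : ρ.IsHermitian then
    ∑ i, ∑ j, chat f (hρ.eigenvalues i) (hρ.eigenvalues j) *
      Complex.normSq (star ⇑(hρ.eigenvectorBasis i) ⬝ᵥ A *ᵥ ⇑(hρ.eigenvectorBasis j))
  else 0

/-- The complex diagonal matrix with real diagonal entries `d`. -/
noncomputable def rdiag {ι : Type} [DecidableEq ι] (d : ι → ℝ) : Matrix ι ι ℂ :=
  diagonal fun i => (d i : ℂ)

/-- The diagonal quadratic form `∑ d i * |x i|²`. -/
noncomputable def diagForm {ι : Type} [Fintype ι] (d : ι → ℝ) (x : ι → ℂ) : ℝ :=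
  ∑ i, d i * Complex.normSq (x i)

section Diagonal

variable {ι κ : Type}

section DecidableEq

variable [DecidableEq ι]

lemma rdiag_mul_rdiag [Fintype ι] (d e : ι → ℝ) : rdiag d * rdiag e = rdiag fun i => d i * e i := by
  simp [rdiag, diagonal_mul_diagonal]

lemma rdiag_conjTranspose (d : ι → ℝ) : (rdiag d)ᴴ = rdiag d := by
  rw [rdiag, diagonal_conjTranspose]
  congr 1
  ext i
  simp

lemma rdiag_eq_one {d : ι → ℝ} (h : ∀ i, d i = 1) : rdiag d = 1 := by
  simp [rdiag, h]

lemma rdiag_mulVec_apply [Fintype ι] (d : ι → ℝ) (x : ι → ℂ) (i : ι) :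
    (rdiag d *ᵥ x) i = d i * x i := by
  simp [rdiag, mulVec_diagonal]

lemma posDef_rdiag {d : ι → ℝ} (h : ∀ i, 0 < d i) : (rdiag d).PosDef :=
  PosDef.diagonal fun i => by simpa using h i

lemma posSemidef_rdiag {d : ι → ℝ} (h : ∀ i, 0 ≤ d i) : (rdiag d).PosSemidef :=
  PosSemidef.diagonal fun i => by simpa using h i

lemma star_dotProduct_rdiag_mulVec [Fintype ι] (d : ι → ℝ) (x : ι → ℂ) :
    star x ⬝ᵥ (rdiag d *ᵥ x) = (diagForm d x : ℂ) := by
  simp only [dotProduct, rdiag_mulVec_apply, diagForm, Pi.star_apply, RCLike.star_def]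
  push_cast
  refine Finset.sum_congr rfl fun i _ => ?_
  rw [Complex.normSq_eq_conj_mul_self]
  ring

lemma isHermitian_conj_rdiag [Fintype ι] (E : Matrix κ ι ℂ) (d : ι → ℝ) :
    (E * rdiag d * Eᴴ).IsHermitian := by
  rw [IsHermitian, conjTranspose_mul, conjTranspose_mul, rdiag_conjTranspose,
    conjTranspose_conjTranspose, Matrix.mul_assoc]

end DecidableEq

variable [Fintype ι] [Fintype κ]

lemma star_mulVec_dotProduct (V : Matrix κ ι ℂ) (x : ι → ℂ) (y : κ → ℂ) :
    star (V *ᵥ x) ⬝ᵥ y = star x ⬝ᵥ (Vᴴ *ᵥ y) := by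
  rw [star_mulVec, dotProduct_mulVec]

/-- If `W` intertwines two real diagonal matrices, it intertwines their images under `g`. -/
lemma rdiag_intertwine [DecidableEq ι] [DecidableEq κ] (g : ℝ → ℝ) {d : κ → ℝ} {e : ι → ℝ} {W : Matrix κ ι ℂ}
    (h : rdiag d * W = W * rdiag e) :
    (rdiag fun i => g (d i)) * W = W * rdiag fun i => g (e i) := by
  ext i j
  have hij := congrFun (congrFun h i) j
  simp only [rdiag, diagonal_mul, mul_diagonal] at hij ⊢
  by_cases hW : W i j = 0
  · simp [hW]
  · have : (d i : ℂ) = e j := mul_right_cancel₀ hW (by rw [hij, mul_comm])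
    rw [Complex.ofReal_inj.mp this, mul_comm]

end Diagonal

section MatFun

variable {ι κ : Type} [Fintype ι] [DecidableEq ι] [Fintype κ] [DecidableEq κ]

lemma exists_unitary_spectral {M : Matrix ι ι ℂ} (hM : M.IsHermitian) :
    ∃ E : Matrix ι ι ℂ, Eᴴ * E = 1 ∧ E * Eᴴ = 1 ∧ (∀ i j, E i j = hM.eigenvectorBasis j i) ∧
      M = E * rdiag hM.eigenvalues * Eᴴ ∧
      ∀ g : ℝ → ℝ, matFun g M = E * (rdiag fun i => g (hM.eigenvalues i)) * Eᴴ := by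
  refine ⟨hM.eigenvectorUnitary, ?_, ?_, fun i j => rfl, ?_, fun g => ?_⟩
  · exact Unitary.coe_star_mul_self hM.eigenvectorUnitary
  · exact Unitary.coe_mul_star_self hM.eigenvectorUnitary
  · exact hM.spectral_theorem
  · rw [matFun, dif_pos hM]
    ext a b
    simp only [Matrix.sum_apply, Matrix.smul_apply, vecMulVec_apply, Matrix.mul_apply (N := _ᴴ),
      rdiag, mul_diagonal, conjTranspose_apply, IsHermitian.eigenvectorUnitary_apply,
      Pi.star_apply, smul_eq_mul]
    exact Finset.sum_congr rfl fun i _ => by ring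

lemma matFun_intertwine (g : ℝ → ℝ) {M : Matrix κ κ ℂ} (hM : M.IsHermitian)
    {Q : Matrix κ ι ℂ} {e : ι → ℝ} (h : M * Q = Q * rdiag e) :
    matFun g M * Q = Q * rdiag fun i => g (e i) := by
  obtain ⟨E, h1, h2, -, hE, hg⟩ := exists_unitary_spectral hM
  have key : rdiag hM.eigenvalues * (Eᴴ * Q) = (Eᴴ * Q) * rdiag e := by
    rw [Matrix.mul_assoc Eᴴ, ← h, congrArg (· * Q) hE]
    simp only [← Matrix.mul_assoc, h1, Matrix.one_mul]
  rw [hg, Matrix.mul_assoc, Matrix.mul_assoc, rdiag_intertwine g key, ← Matrix.mul_assoc,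
    ← Matrix.mul_assoc, h2, Matrix.one_mul]

lemma matFun_conj_rdiag (g : ℝ → ℝ) {E : Matrix ι ι ℂ} (h1 : Eᴴ * E = 1) (h2 : E * Eᴴ = 1)
    (d : ι → ℝ) : matFun g (E * rdiag d * Eᴴ) = E * (rdiag fun i => g (d i)) * Eᴴ := by
  have := matFun_intertwine g (isHermitian_conj_rdiag E d) (Q := E) (e := d)
    (by rw [Matrix.mul_assoc, h1, Matrix.mul_one])
  rw [← this, Matrix.mul_assoc _ E, h2, Matrix.mul_one]

lemma matFun_rdiag (g : ℝ → ℝ) (d : ι → ℝ) : matFun g (rdiag d) = rdiag fun i => g (d i) := by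
  simpa using matFun_conj_rdiag g (E := 1) (by simp) (by simp) d

end MatFun

/-- Inversion is antitone on positive definite matrices. -/
lemma posSemidef_inv_sub_inv {ι : Type} [Fintype ι] [DecidableEq ι] {A B : Matrix ι ι ℂ}
    (hA : A.PosDef) (hB : B.PosDef) (h : (B - A).PosSemidef) : (A⁻¹ - B⁻¹).PosSemidef := by
  have := hB.isUnit.invertible
  have := hA.inv.isUnit.invertible
  have hAi : A⁻¹⁻¹ = A := nonsing_inv_nonsing_inv A ((isUnit_iff_isUnit_det A).mp hA.isUnit)
  have h1 := PosDef.fromBlocks₁₁ (1 : Matrix ι ι ℂ) A⁻¹ hB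
  have h2 := PosDef.fromBlocks₂₂ B (1 : Matrix ι ι ℂ) hA.inv
  simp only [conjTranspose_one, Matrix.one_mul, Matrix.mul_one, hAi] at h1 h2
  exact h1.mp (h2.mpr h)

lemma OperatorMonotone.inv_comp_inv {f : ℝ → ℝ} (hf : OperatorMonotone f)
    (hpos : ∀ t > 0, 0 < f t) : OperatorMonotone fun t => (f t⁻¹)⁻¹ := by
  have inv_conj : ∀ {k : ℕ} {E : Matrix (Fin k) (Fin k) ℂ} {d : Fin k → ℝ}, Eᴴ * E = 1 →
      E * Eᴴ = 1 → (∀ i, 0 < d i) →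
      (E * rdiag d * Eᴴ)⁻¹ = E * (rdiag fun i => (d i)⁻¹) * Eᴴ := by
    intro k E d h1 h2 hd
    apply inv_eq_right_inv
    calc E * rdiag d * Eᴴ * (E * (rdiag fun i => (d i)⁻¹) * Eᴴ)
        = E * (rdiag d * (Eᴴ * E) * rdiag fun i => (d i)⁻¹) * Eᴴ := by
          simp only [Matrix.mul_assoc]
      _ = 1 := by
          rw [h1, Matrix.mul_one, rdiag_mul_rdiag,
            rdiag_eq_one fun i => mul_inv_cancel₀ (hd i).ne', Matrix.mul_one, h2]
  have main : ∀ {k : ℕ} {M : Matrix (Fin k) (Fin k) ℂ}, M.PosDef →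
      (matFun f M⁻¹).PosDef ∧ matFun (fun t => (f t⁻¹)⁻¹) M = (matFun f M⁻¹)⁻¹ := by
    intro k M hM
    obtain ⟨E, h1, h2, -, hE, hg⟩ := exists_unitary_spectral hM.1
    have hd := hM.eigenvalues_pos
    have hfd : ∀ i, 0 < f (hM.1.eigenvalues i)⁻¹ := fun i => hpos _ (inv_pos.mpr (hd i))
    have hinv : matFun f M⁻¹ = E * (rdiag fun i => f (hM.1.eigenvalues i)⁻¹) * Eᴴ := by
      conv_lhs => rw [hE, inv_conj h1 h2 hd]
      exact matFun_conj_rdiag f h1 h2 _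
    refine ⟨?_, ?_⟩
    · rw [hinv]
      exact (posDef_rdiag hfd).mul_mul_conjTranspose_same
        (vecMul_injective_of_isUnit ((isUnit_iff_exists).mpr ⟨Eᴴ, h2, h1⟩))
    · rw [hinv, hg, inv_conj h1 h2 hfd]
  intro k A B hA hB hAB
  rw [(main hA).2, (main hB).2]
  exact posSemidef_inv_sub_inv (main hB).1 (main hA).1
    (hf k _ _ hB.inv hA.inv (posSemidef_inv_sub_inv hA hB hAB))

lemma OperatorMonotone.le_of_le {f : ℝ → ℝ} (hf : OperatorMonotone f) {s t : ℝ} (hs : 0 < s)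
    (hst : s ≤ t) : f s ≤ f t := by
  have hsub : (rdiag fun _ : Fin 1 => t) - (rdiag fun _ => s) = rdiag fun _ => t - s := by
    simp [rdiag, diagonal_sub]
  have h := hf 1 (rdiag fun _ => s) (rdiag fun _ => t) (posDef_rdiag fun _ => hs)
    (posDef_rdiag fun _ => hs.trans_le hst)
    (by rw [hsub]; exact posSemidef_rdiag fun _ => sub_nonneg.mpr hst)
  rw [matFun_rdiag, matFun_rdiag] at h
  have := h.diag_nonneg (i := 0)
  simp only [rdiag, Matrix.sub_apply, diagonal_apply_eq, ← Complex.ofReal_sub] at this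
  exact sub_nonneg.mp (Complex.zero_le_real.mp this)

/-- Symmetry under `f t = t * f (1 / t)` bounds the growth of a monotone `f` under dilations. -/
lemma OperatorMonotone.dilation_le {f : ℝ → ℝ} (hf : OperatorMonotone f)
    (hsymm : ∀ t > 0, f t = t * f (1 / t)) {c s : ℝ} (hc : 1 ≤ c) (hs : 0 < s) :
    f (c * s) ≤ c * f s := by
  have hc0 : 0 < c := one_pos.trans_le hc
  rw [hsymm (c * s) (by positivity), hsymm s hs, mul_assoc]
  gcongr
  exact hf.le_of_le (by positivity) (one_div_le_one_div_of_le hs (le_mul_of_one_le_left hs.le hc))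

section Hansen

variable {ι κ : Type} [Fintype ι] [DecidableEq ι] [Fintype κ] [DecidableEq κ]

/-- A diagonal matrix is dominated by a matrix for which the range of the isometry `V` is
reducing. -/
lemma posSemidef_pinching_sub {d : κ → ℝ} {e : ι → ℝ} {V : Matrix κ ι ℂ} {ε c : ℝ}
    (hd : ∀ i, 0 ≤ d i) (hε : 0 < ε) (hc : ∀ i, (1 + ε⁻¹) * d i ≤ c)
    (hVe : Vᴴ * rdiag d * V = rdiag e) :
    (V * (rdiag fun i => (1 + ε) * e i) * Vᴴ + (1 - V * Vᴴ)ᴴ * (rdiag fun _ => c) * (1 - V * Vᴴ)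
      - rdiag d).PosSemidef := by
  set P := V * Vᴴ with hP
  have hPH : Pᴴ = P := by simp [hP]
  have hQH : (1 - P)ᴴ = 1 - P := by simp [hPH]
  have h1 := (posSemidef_rdiag (d := fun i => c - (1 + ε⁻¹) * d i)
    fun i => sub_nonneg.mpr (hc i)).conjTranspose_mul_mul_same (1 - P)
  have h2 := ((posSemidef_rdiag hd).conjTranspose_mul_mul_same
    (P - (ε⁻¹ : ℂ) • (1 - P))).smul (a := ε) hε.le
  have hsub : (rdiag fun i => c - (1 + ε⁻¹) * d i) =
      (rdiag fun _ => c) - ((1 + ε⁻¹ : ℝ) : ℂ) • rdiag d := by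
    ext i j
    by_cases hij : i = j <;> simp [rdiag, hij]
  have hmul : (rdiag fun i => (1 + ε) * e i) = ((1 + ε : ℝ) : ℂ) • rdiag e := by
    ext i j
    by_cases hij : i = j <;> simp [rdiag, hij]
  have hPX : V * rdiag e * Vᴴ = P * rdiag d * P := by
    rw [← hVe, hP]
    simp only [Matrix.mul_assoc]
  have hadj : (P - (ε⁻¹ : ℂ) • (1 - P))ᴴ = P - (ε⁻¹ : ℂ) • (1 - P) := by
    rw [conjTranspose_sub, conjTranspose_smul, hPH, hQH]
    simp
  convert h1.add h2 using 1
  rw [hmul, Matrix.mul_smul, Matrix.smul_mul, hPX, hadj, hQH, hsub]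
  have hεC : (ε : ℂ) ≠ 0 := by exact_mod_cast hε.ne'
  rw [← Complex.coe_smul]
  simp only [Matrix.mul_sub, Matrix.sub_mul, Matrix.smul_mul, Matrix.mul_smul, Matrix.mul_one,
    Matrix.one_mul, smul_sub, smul_smul, Complex.ofReal_add, Complex.ofReal_one,
    Complex.ofReal_inv]
  match_scalars <;> field_simp <;> ring

lemma OperatorMonotone.posSemidef_compression {f : ℝ → ℝ} (hf : OperatorMonotone f) {k : ℕ}
    {d : Fin k → ℝ} {e : ι → ℝ} {V : Matrix (Fin k) ι ℂ} (hd : ∀ i, 0 < d i)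
    (hV : Vᴴ * V = 1) (hVe : Vᴴ * rdiag d * V = rdiag e) {ε : ℝ} (hε : 0 < ε) :
    ((rdiag fun i => f ((1 + ε) * e i)) - Vᴴ * (rdiag fun i => f (d i)) * V).PosSemidef := by
  obtain ⟨c, hc⟩ : ∃ c, ∀ i, (1 + ε⁻¹) * d i ≤ c := by
    obtain ⟨c, hc⟩ := (Set.finite_range fun i => (1 + ε⁻¹) * d i).bddAbove
    exact ⟨c, fun i => hc ⟨i, rfl⟩⟩
  have hW := posSemidef_pinching_sub (fun i => (hd i).le) hε hc hVe
  set W := V * (rdiag fun i => (1 + ε) * e i) * Vᴴ +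
    (1 - V * Vᴴ)ᴴ * (rdiag fun _ => c) * (1 - V * Vᴴ) with hWdef
  have hWpos : W.PosDef := by
    simpa using (posDef_rdiag hd).add_posSemidef hW
  have hQV : (1 - V * Vᴴ) * V = 0 := by
    rw [Matrix.sub_mul, Matrix.mul_assoc, hV, Matrix.one_mul, Matrix.mul_one, sub_self]
  have hWV : W * V = V * rdiag fun i => (1 + ε) * e i := by
    rw [hWdef, Matrix.add_mul, Matrix.mul_assoc _ _ V, Matrix.mul_assoc _ _ V, hQV, hV,
      Matrix.mul_zero, add_zero, Matrix.mul_one]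
  have h := (hf k _ _ (posDef_rdiag hd) hWpos hW).conjTranspose_mul_mul_same V
  rwa [matFun_rdiag, Matrix.mul_sub, Matrix.sub_mul, Matrix.mul_assoc _ _ V,
    matFun_intertwine f hWpos.1 hWV, ← Matrix.mul_assoc, hV, Matrix.one_mul] at h

/-- Hansen's inequality for a diagonal matrix compressed to a diagonal matrix. -/
lemma OperatorMonotone.diagForm_compression_le {f : ℝ → ℝ} (hf : OperatorMonotone f)
    (hsymm : ∀ t > 0, f t = t * f (1 / t))
    {d : κ → ℝ} {e : ι → ℝ} {V : Matrix κ ι ℂ} (hd : ∀ i, 0 < d i) (he : ∀ i, 0 < e i)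
    (hV : Vᴴ * V = 1) (hVe : Vᴴ * rdiag d * V = rdiag e) (x : ι → ℂ) :
    diagForm (fun i => f (d i)) (V *ᵥ x) ≤ diagForm (fun i => f (e i)) x := by
  let φ := (Fintype.equivFin κ).symm
  let V' := V.submatrix φ id
  have hV' : V'ᴴ * V' = 1 := by
    rw [← hV]
    exact submatrix_mul_equiv Vᴴ V id φ id
  have hVe' : V'ᴴ * (rdiag fun i => d (φ i)) * V' = rdiag e := by
    have hdφ : (rdiag fun i => d (φ i)) = (rdiag d).submatrix φ φ :=
      (submatrix_diagonal_equiv (fun i => (d i : ℂ)) φ).symm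
    rw [← hVe, hdφ, conjTranspose_submatrix, submatrix_mul_equiv, submatrix_mul_equiv,
      submatrix_id_id]
  have hle : ∀ ε > 0, diagForm (fun i => f (d i)) (V *ᵥ x) ≤
      (1 + ε) * diagForm (fun i => f (e i)) x := by
    intro ε hε
    have h := (hf.posSemidef_compression (fun i => hd (φ i)) hV' hVe' hε).dotProduct_mulVec_nonneg x
    rw [sub_mulVec, dotProduct_sub, ← mulVec_mulVec, ← mulVec_mulVec, ← star_mulVec_dotProduct,
      star_dotProduct_rdiag_mulVec, star_dotProduct_rdiag_mulVec, ← Complex.ofReal_sub,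
      Complex.zero_le_real, sub_nonneg] at h
    calc diagForm (fun i => f (d i)) (V *ᵥ x)
        = diagForm (fun i => f (d (φ i))) (V' *ᵥ x) :=
          (Equiv.sum_comp φ fun i => f (d i) * Complex.normSq ((V *ᵥ x) i)).symm
      _ ≤ _ := h
      _ ≤ _ := by
          rw [diagForm, diagForm, Finset.mul_sum]
          refine Finset.sum_le_sum fun i _ => ?_
          rw [← mul_assoc]
          exact mul_le_mul_of_nonneg_right
            (hf.dilation_le hsymm (by linarith) (he i)) (Complex.normSq_nonneg _)
  have hlim : Filter.Tendsto (fun ε : ℝ => (1 + ε) * diagForm (fun i => f (e i)) x)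
      (nhdsWithin 0 (Set.Ioi 0)) (nhds (diagForm (fun i => f (e i)) x)) := by
    have : Continuous fun ε : ℝ => (1 + ε) * diagForm (fun i => f (e i)) x := by fun_prop
    simpa using (this.tendsto 0).mono_left nhdsWithin_le_nhds
  exact ge_of_tendsto hlim (Filter.eventually_of_mem self_mem_nhdsWithin hle)

/-- The perspective form of `OperatorMonotone.diagForm_compression_le`. -/
lemma OperatorMonotone.diagForm_perspective_le {f : ℝ → ℝ} (hf : OperatorMonotone f)
    (hsymm : ∀ t > 0, f t = t * f (1 / t))
    {d : κ → ℝ} {a b : ι → ℝ} {T : Matrix κ ι ℂ} (hd : ∀ i, 0 < d i)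
    (ha : ∀ i, 0 < a i) (hb : ∀ i, 0 < b i)
    (hTb : Tᴴ * T = rdiag b) (hTa : Tᴴ * rdiag d * T = rdiag a) (x : ι → ℂ) :
    diagForm (fun i => f (d i)) (T *ᵥ x) ≤ diagForm (fun i => b i * f (a i / b i)) x := by
  have hs : ∀ i, √(b i) ≠ 0 := fun i => (Real.sqrt_pos.mpr (hb i)).ne'
  have hss : ∀ i, √(b i) * √(b i) = b i := fun i => Real.mul_self_sqrt (hb i).le
  let r : ι → ℝ := fun i => (√(b i))⁻¹
  have h := hf.diagForm_compression_le hsymm (V := T * rdiag r) (e := fun i => a i / b i) hd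
    (fun i => div_pos (ha i) (hb i)) (by
      rw [conjTranspose_mul, rdiag_conjTranspose, Matrix.mul_assoc, ← Matrix.mul_assoc Tᴴ, hTb,
        rdiag_mul_rdiag, rdiag_mul_rdiag]
      refine rdiag_eq_one fun i => ?_
      have hr : r i * √(b i) = 1 := inv_mul_cancel₀ (hs i)
      rw [← hss i]
      linear_combination (r i * √(b i) + 1) * hr) (by
      rw [conjTranspose_mul, rdiag_conjTranspose, Matrix.mul_assoc, Matrix.mul_assoc,
        ← Matrix.mul_assoc (rdiag d), ← Matrix.mul_assoc Tᴴ, ← Matrix.mul_assoc Tᴴ, hTa,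
        rdiag_mul_rdiag, rdiag_mul_rdiag]
      congr 1
      ext i
      have hr : r i * √(b i) = 1 := inv_mul_cancel₀ (hs i)
      rw [eq_div_iff (hb i).ne', ← hss i]
      linear_combination a i * (r i * √(b i) + 1) * hr) (rdiag (fun i => √(b i)) *ᵥ x)
  rw [mulVec_mulVec, Matrix.mul_assoc, rdiag_mul_rdiag,
    rdiag_eq_one fun i => inv_mul_cancel₀ (hs i), Matrix.mul_one] at h
  refine h.trans_eq (Finset.sum_congr rfl fun i _ => ?_)
  rw [rdiag_mulVec_apply, Complex.normSq_mul, Complex.normSq_ofReal, hss]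
  ring

/-- Joint concavity of the perspective of an operator monotone function, for pairs of commuting
matrices given by simultaneous diagonalisations. -/
lemma OperatorMonotone.diagForm_perspective_concave {f : ℝ → ℝ} (hf : OperatorMonotone f)
    (hsymm : ∀ t > 0, f t = t * f (1 / t)) {s₁ s₂ : ℝ} (hs₁ : 0 ≤ s₁) (hs₂ : 0 ≤ s₂)
    {U U₁ U₂ : Matrix ι ι ℂ} {a b a₁ b₁ a₂ b₂ : ι → ℝ} (hU : Uᴴ * U = 1) (hU' : U * Uᴴ = 1)
    (ha : ∀ i, 0 < a i) (hb : ∀ i, 0 < b i) (ha₁ : ∀ i, 0 < a₁ i) (hb₁ : ∀ i, 0 < b₁ i)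
    (ha₂ : ∀ i, 0 < a₂ i) (hb₂ : ∀ i, 0 < b₂ i)
    (hA : U * rdiag a * Uᴴ =
      (s₁ : ℂ) • (U₁ * rdiag a₁ * U₁ᴴ) + (s₂ : ℂ) • (U₂ * rdiag a₂ * U₂ᴴ))
    (hB : U * rdiag b * Uᴴ =
      (s₁ : ℂ) • (U₁ * rdiag b₁ * U₁ᴴ) + (s₂ : ℂ) • (U₂ * rdiag b₂ * U₂ᴴ)) (x : ι → ℂ) :
    s₁ * diagForm (fun i => b₁ i * f (a₁ i / b₁ i)) (U₁ᴴ *ᵥ x) +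
      s₂ * diagForm (fun i => b₂ i * f (a₂ i / b₂ i)) (U₂ᴴ *ᵥ x) ≤
    diagForm (fun i => b i * f (a i / b i)) (Uᴴ *ᵥ x) := by
  have unconj : ∀ {c c₁ c₂ : ι → ℝ}, U * rdiag c * Uᴴ =
      (s₁ : ℂ) • (U₁ * rdiag c₁ * U₁ᴴ) + (s₂ : ℂ) • (U₂ * rdiag c₂ * U₂ᴴ) →
      Uᴴ * ((s₁ : ℂ) • (U₁ * rdiag c₁ * U₁ᴴ) + (s₂ : ℂ) • (U₂ * rdiag c₂ * U₂ᴴ)) * U =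
      rdiag c := by
    intro c c₁ c₂ h
    rw [← h]
    calc Uᴴ * (U * rdiag c * Uᴴ) * U = (Uᴴ * U) * rdiag c * (Uᴴ * U) := by
          simp only [Matrix.mul_assoc]
      _ = rdiag c := by rw [hU, Matrix.one_mul, Matrix.mul_one]
  let r₁ : ι → ℝ := fun i => √(s₁ * b₁ i)
  let r₂ : ι → ℝ := fun i => √(s₂ * b₂ i)
  have hr₁ : ∀ i, r₁ i * r₁ i = s₁ * b₁ i := fun i => Real.mul_self_sqrt (mul_nonneg hs₁ (hb₁ i).le)
  have hr₂ : ∀ i, r₂ i * r₂ i = s₂ * b₂ i := fun i => Real.mul_self_sqrt (mul_nonneg hs₂ (hb₂ i).le)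
  let T : Matrix (ι ⊕ ι) ι ℂ := fromRows (rdiag r₁ * U₁ᴴ * U) (rdiag r₂ * U₂ᴴ * U)
  have block : ∀ g₁ g₂ : ι → ℝ, Tᴴ * rdiag (Sum.elim g₁ g₂) * T =
      Uᴴ * ((s₁ : ℂ) • (U₁ * (rdiag fun i => b₁ i * g₁ i) * U₁ᴴ) +
        (s₂ : ℂ) • (U₂ * (rdiag fun i => b₂ i * g₂ i) * U₂ᴴ)) * U := by
    intro g₁ g₂
    have hD : rdiag (Sum.elim g₁ g₂) = fromBlocks (rdiag g₁) 0 0 (rdiag g₂) := by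
      rw [rdiag, rdiag, rdiag, fromBlocks_diagonal]
      congr 1
      ext i
      cases i <;> rfl
    have hsq : ∀ (s : ℝ) (r b g : ι → ℝ) (Y : Matrix ι ι ℂ), (∀ i, r i * r i = s * b i) →
        rdiag r * (rdiag g * (rdiag r * Y)) = (s : ℂ) • ((rdiag fun i => b i * g i) * Y) := by
      intro s r b g Y hr
      rw [← Matrix.mul_assoc, ← Matrix.mul_assoc, rdiag_mul_rdiag, rdiag_mul_rdiag,
        ← Matrix.smul_mul]
      congr 1
      ext i j
      by_cases hij : i = j
      · subst hij
        have : r i * g i * r i = s * (b i * g i) := by linear_combination g i * hr i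
        simp only [rdiag, diagonal_apply_eq, Matrix.smul_apply, this, smul_eq_mul]
        push_cast
        rfl
      · simp [rdiag, hij]
    rw [hD, conjTranspose_fromRows_eq_fromCols_conjTranspose, fromCols_mul_fromBlocks,
      fromCols_mul_fromRows]
    simp only [conjTranspose_mul, conjTranspose_conjTranspose, rdiag_conjTranspose,
      Matrix.mul_zero, add_zero, zero_add, Matrix.mul_assoc, hsq s₁ r₁ b₁ _ _ hr₁,
      hsq s₂ r₂ b₂ _ _ hr₂, Matrix.mul_smul, Matrix.smul_mul, Matrix.mul_add, Matrix.add_mul]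
  have h := hf.diagForm_perspective_le hsymm (T := T) (a := a) (b := b)
    (d := Sum.elim (fun i => a₁ i / b₁ i) fun i => a₂ i / b₂ i)
    (by rintro (i | i) <;> [exact div_pos (ha₁ i) (hb₁ i); exact div_pos (ha₂ i) (hb₂ i)]) ha hb
    (by
      have := block (fun _ => 1) fun _ => 1
      rw [rdiag_eq_one (by rintro (i | i) <;> rfl), Matrix.mul_one] at this
      simp only [mul_one] at this
      rw [this, unconj hB])
    (by
      rw [block]
      simp only [fun i => mul_div_cancel₀ (a₁ i) (hb₁ i).ne',
        fun i => mul_div_cancel₀ (a₂ i) (hb₂ i).ne', unconj hA]) (Uᴴ *ᵥ x)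
  refine le_trans (le_of_eq ?_) h
  have hT₁ : rdiag r₁ * U₁ᴴ * U * Uᴴ = rdiag r₁ * U₁ᴴ := by
    rw [Matrix.mul_assoc _ U, hU', Matrix.mul_one]
  have hT₂ : rdiag r₂ * U₂ᴴ * U * Uᴴ = rdiag r₂ * U₂ᴴ := by
    rw [Matrix.mul_assoc _ U, hU', Matrix.mul_one]
  have hTx : T *ᵥ (Uᴴ *ᵥ x) =
      Sum.elim (rdiag r₁ *ᵥ (U₁ᴴ *ᵥ x)) (rdiag r₂ *ᵥ (U₂ᴴ *ᵥ x)) := by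
    rw [fromRows_mulVec, mulVec_mulVec, mulVec_mulVec, mulVec_mulVec, mulVec_mulVec, hT₁, hT₂]
  rw [hTx]
  simp only [diagForm, Fintype.sum_sum_type, Sum.elim_inl, Sum.elim_inr, Finset.mul_sum,
    rdiag_mulVec_apply, Complex.normSq_mul, Complex.normSq_ofReal, hr₁, hr₂]
  congr 1 <;> exact Finset.sum_congr rfl fun i _ => by ring

end Hansen

section Convexity

variable {ι : Type} [Fintype ι]

lemma diagForm_chat {f : ℝ → ℝ} (hpos : ∀ t > 0, 0 < f t)
    (hsymm : ∀ t > 0, f t = t * f (1 / t)) {a b : ι → ℝ} (ha : ∀ i, 0 < a i)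
    (hb : ∀ i, 0 < b i) (z : ι → ℂ) :
    diagForm (fun i => chat f (a i) (b i)) z =
      diagForm (fun i => a i ^ 2 / (b i * f (a i / b i))) z +
      diagForm (fun i => b i ^ 2 / (b i * f (a i / b i))) z -
      2 * diagForm (fun i => b i * (f (a i / b i)⁻¹)⁻¹) z := by
  simp only [diagForm, Finset.mul_sum, ← Finset.sum_add_distrib, ← Finset.sum_sub_distrib]
  refine Finset.sum_congr rfl fun i _ => ?_
  have hai := ha i
  have hbi := hb i
  have hfi := hpos _ (div_pos hai hbi)
  have hfi' := hpos _ (inv_pos.mpr (div_pos hai hbi))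
  have hs := hsymm _ (div_pos hai hbi)
  rw [one_div] at hs
  have hc : b i * (f (a i / b i)⁻¹)⁻¹ = a i / f (a i / b i) := by
    rw [← div_eq_mul_inv, div_eq_div_iff hfi'.ne' hfi.ne', hs]
    field_simp
  rw [hc, chat]
  field_simp
  ring

variable [DecidableEq ι]

/-- Joint convexity of `(C, M) ↦ ⟪x, C M⁻¹ C x⟫` together with antitonicity in `M`. -/
lemma diagForm_sq_div_le {s₁ s₂ : ℝ} (hs₁ : 0 ≤ s₁) (hs₂ : 0 ≤ s₂)
    {U U₁ U₂ : Matrix ι ι ℂ} {c m c₁ m₁ c₂ m₂ : ι → ℝ} (hU : Uᴴ * U = 1)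
    (hm : ∀ i, 0 < m i) (hm₁ : ∀ i, 0 < m₁ i) (hm₂ : ∀ i, 0 < m₂ i)
    (hC : U * rdiag c * Uᴴ =
      (s₁ : ℂ) • (U₁ * rdiag c₁ * U₁ᴴ) + (s₂ : ℂ) • (U₂ * rdiag c₂ * U₂ᴴ))
    (hM : ∀ x, s₁ * diagForm m₁ (U₁ᴴ *ᵥ x) + s₂ * diagForm m₂ (U₂ᴴ *ᵥ x) ≤
      diagForm m (Uᴴ *ᵥ x)) (x : ι → ℂ) :
    diagForm (fun i => c i ^ 2 / m i) (Uᴴ *ᵥ x) ≤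
      s₁ * diagForm (fun i => c₁ i ^ 2 / m₁ i) (U₁ᴴ *ᵥ x) +
      s₂ * diagForm (fun i => c₂ i ^ 2 / m₂ i) (U₂ᴴ *ᵥ x) := by
  set y := Uᴴ *ᵥ x with hy
  set w := U *ᵥ (rdiag (fun i => c i / m i) *ᵥ y) with hw
  have hUw : Uᴴ *ᵥ w = rdiag (fun i => c i / m i) *ᵥ y := by
    rw [hw, mulVec_mulVec, hU, one_mulVec]
  have hMw : diagForm m (Uᴴ *ᵥ w) = diagForm (fun i => c i ^ 2 / m i) y := by
    refine Finset.sum_congr rfl fun i _ => ?_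
    rw [hUw, rdiag_mulVec_apply, Complex.normSq_mul, Complex.normSq_ofReal]
    have := (hm i).ne'
    field_simp
  have hconj : ∀ (V : Matrix ι ι ℂ) (e : ι → ℝ), star w ⬝ᵥ ((V * rdiag e * Vᴴ) *ᵥ x) =
      star (Vᴴ *ᵥ w) ⬝ᵥ (rdiag e *ᵥ (Vᴴ *ᵥ x)) := by
    intro V e
    rw [star_mulVec_dotProduct Vᴴ, conjTranspose_conjTranspose, mulVec_mulVec, mulVec_mulVec,
      Matrix.mul_assoc]
  have hcross : (star w ⬝ᵥ ((U * rdiag c * Uᴴ) *ᵥ x)).re =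
      diagForm (fun i => c i ^ 2 / m i) y := by
    rw [hconj, hUw, ← hy, star_mulVec_dotProduct, rdiag_conjTranspose, mulVec_mulVec,
      rdiag_mul_rdiag, star_dotProduct_rdiag_mulVec, Complex.ofReal_re]
    congr 1
    ext i
    ring
  have young : ∀ {e k : ι → ℝ} (u v : ι → ℂ), (∀ i, 0 < k i) →
      2 * (star u ⬝ᵥ (rdiag e *ᵥ v)).re - diagForm k u ≤ diagForm (fun i => e i ^ 2 / k i) v := by
    intro e k u v hk
    rw [dotProduct, Complex.re_sum, diagForm, diagForm, Finset.mul_sum, ← Finset.sum_sub_distrib]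
    refine Finset.sum_le_sum fun i _ => ?_
    have hki := hk i
    have key : 0 ≤ k i * Complex.normSq (u i - (e i / k i : ℝ) * v i) :=
      mul_nonneg hki.le (Complex.normSq_nonneg _)
    have hexp : k i * Complex.normSq (u i - (e i / k i : ℝ) * v i) =
        e i ^ 2 / k i * Complex.normSq (v i) -
          (2 * (star u i * (rdiag e *ᵥ v) i).re - k i * Complex.normSq (u i)) := by
      rw [rdiag_mulVec_apply]
      simp only [Complex.normSq_apply, Pi.star_apply, RCLike.star_def, Complex.mul_re,
        Complex.mul_im, Complex.sub_re, Complex.sub_im, Complex.ofReal_re, Complex.ofReal_im,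
        Complex.conj_re, Complex.conj_im]
      field_simp
      ring
    linarith
  have h₁ := mul_le_mul_of_nonneg_left (young (e := c₁) (U₁ᴴ *ᵥ w) (U₁ᴴ *ᵥ x) hm₁) hs₁
  have h₂ := mul_le_mul_of_nonneg_left (young (e := c₂) (U₂ᴴ *ᵥ w) (U₂ᴴ *ᵥ x) hm₂) hs₂
  have hMw' := hM w
  rw [hMw] at hMw'
  rw [hC, add_mulVec, smul_mulVec, smul_mulVec, dotProduct_add, dotProduct_smul, dotProduct_smul,
    hconj, hconj, Complex.add_re, smul_eq_mul, smul_eq_mul, Complex.re_ofReal_mul,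
    Complex.re_ofReal_mul] at hcross
  linarith

lemma diagForm_chat_convex {f : ℝ → ℝ} (hf : OperatorMonotone f) (hpos : ∀ t > 0, 0 < f t)
    (hsymm : ∀ t > 0, f t = t * f (1 / t)) {s₁ s₂ : ℝ} (hs₁ : 0 ≤ s₁) (hs₂ : 0 ≤ s₂)
    {U U₁ U₂ : Matrix ι ι ℂ} {a b a₁ b₁ a₂ b₂ : ι → ℝ} (hU : Uᴴ * U = 1) (hU' : U * Uᴴ = 1)
    (ha : ∀ i, 0 < a i) (hb : ∀ i, 0 < b i) (ha₁ : ∀ i, 0 < a₁ i) (hb₁ : ∀ i, 0 < b₁ i)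
    (ha₂ : ∀ i, 0 < a₂ i) (hb₂ : ∀ i, 0 < b₂ i)
    (hA : U * rdiag a * Uᴴ =
      (s₁ : ℂ) • (U₁ * rdiag a₁ * U₁ᴴ) + (s₂ : ℂ) • (U₂ * rdiag a₂ * U₂ᴴ))
    (hB : U * rdiag b * Uᴴ =
      (s₁ : ℂ) • (U₁ * rdiag b₁ * U₁ᴴ) + (s₂ : ℂ) • (U₂ * rdiag b₂ * U₂ᴴ)) (x : ι → ℂ) :
    diagForm (fun i => chat f (a i) (b i)) (Uᴴ *ᵥ x) ≤
      s₁ * diagForm (fun i => chat f (a₁ i) (b₁ i)) (U₁ᴴ *ᵥ x) +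
      s₂ * diagForm (fun i => chat f (a₂ i) (b₂ i)) (U₂ᴴ *ᵥ x) := by
  have hg := hf.inv_comp_inv hpos
  have hgsymm : ∀ t > 0, (f t⁻¹)⁻¹ = t * (f (1 / t)⁻¹)⁻¹ := by
    intro t ht
    have h := hsymm t ht
    have hft := hpos _ (inv_pos.mpr ht)
    rw [one_div] at h ⊢
    rw [inv_inv, h]
    field_simp
  have hconc := hf.diagForm_perspective_concave hsymm hs₁ hs₂ hU hU' ha hb ha₁ hb₁ ha₂ hb₂ hA hB
  have hconc' := hg.diagForm_perspective_concave hgsymm hs₁ hs₂ hU hU' ha hb ha₁ hb₁ ha₂ hb₂ hA hB x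
  have hm : ∀ {a b : ι → ℝ}, (∀ i, 0 < a i) → (∀ i, 0 < b i) → ∀ i, 0 < b i * f (a i / b i) :=
    fun ha hb i => mul_pos (hb i) (hpos _ (div_pos (ha i) (hb i)))
  have h₁ := diagForm_sq_div_le hs₁ hs₂ hU (hm ha hb) (hm ha₁ hb₁) (hm ha₂ hb₂) hA hconc x
  have h₂ := diagForm_sq_div_le hs₁ hs₂ hU (hm ha hb) (hm ha₁ hb₁) (hm ha₂ hb₂) hB hconc x
  rw [diagForm_chat hpos hsymm ha hb, diagForm_chat hpos hsymm ha₁ hb₁,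
    diagForm_chat hpos hsymm ha₂ hb₂]
  linarith

end Convexity

/-- Simultaneous diagonalisation of left and right multiplication by `ρ`, and the resulting
expression of `skewSum` as a diagonal form. -/
lemma exists_unitary_kronecker {ι : Type} [Fintype ι] [DecidableEq ι] {ρ : Matrix ι ι ℂ}
    (hρ : ρ.PosDef) :
    ∃ U : Matrix (ι × ι) (ι × ι) ℂ, Uᴴ * U = 1 ∧ U * Uᴴ = 1 ∧
      U * (rdiag fun p => hρ.1.eigenvalues p.1) * Uᴴ = ρ ⊗ₖ (1 : Matrix ι ι ℂ) ∧
      U * (rdiag fun p => hρ.1.eigenvalues p.2) * Uᴴ = (1 : Matrix ι ι ℂ) ⊗ₖ ρᵀ ∧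
      ∀ (f : ℝ → ℝ) (A : Matrix ι ι ℂ), skewSum f ρ A =
        diagForm (fun p => chat f (hρ.1.eigenvalues p.1) (hρ.1.eigenvalues p.2))
          (Uᴴ *ᵥ fun p => A p.1 p.2) := by
  obtain ⟨E, h1, h2, hvec, hE, -⟩ := exists_unitary_spectral hρ.1
  have h1' : Eᵀ * Eᴴᵀ = 1 := by rw [← transpose_mul, h1, transpose_one]
  have h2' : Eᴴᵀ * Eᵀ = 1 := by rw [← transpose_mul, h2, transpose_one]
  have hct : (Eᴴᵀ)ᴴ = Eᵀ := by ext i j; simp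
  have hfst : (rdiag fun p : ι × ι => hρ.1.eigenvalues p.1) =
      rdiag hρ.1.eigenvalues ⊗ₖ (1 : Matrix ι ι ℂ) := by
    rw [← diagonal_one, rdiag, rdiag, diagonal_kronecker_diagonal]
    simp
  have hsnd : (rdiag fun p : ι × ι => hρ.1.eigenvalues p.2) =
      (1 : Matrix ι ι ℂ) ⊗ₖ rdiag hρ.1.eigenvalues := by
    rw [← diagonal_one, rdiag, rdiag, diagonal_kronecker_diagonal]
    simp
  refine ⟨E ⊗ₖ Eᴴᵀ, ?_, ?_, ?_, ?_, fun f A => ?_⟩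
  · rw [conjTranspose_kronecker, ← mul_kronecker_mul, h1, hct, h1', one_kronecker_one]
  · rw [conjTranspose_kronecker, ← mul_kronecker_mul, h2, hct, h2', one_kronecker_one]
  · rw [hfst, conjTranspose_kronecker, ← mul_kronecker_mul, ← mul_kronecker_mul, hct,
      Matrix.mul_one, h2', ← hE]
  · have hEt : Eᴴᵀ * rdiag hρ.1.eigenvalues * Eᵀ = ρᵀ := by
      rw [congrArg transpose hE, transpose_mul, transpose_mul, rdiag, diagonal_transpose,
        Matrix.mul_assoc]
    rw [hsnd, conjTranspose_kronecker, ← mul_kronecker_mul, ← mul_kronecker_mul, hct,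
      Matrix.mul_one, h2, hEt]
  · rw [skewSum, dif_pos hρ.1, diagForm, Fintype.sum_prod_type]
    refine Finset.sum_congr rfl fun k _ => Finset.sum_congr rfl fun l _ => ?_
    congr 2
    simp only [dotProduct, mulVec, Fintype.sum_prod_type, conjTranspose_apply, kroneckerMap_apply,
      transpose_apply, star_mul', star_star, Pi.star_apply, hvec, Finset.mul_sum]
    exact Finset.sum_congr rfl fun i _ => Finset.sum_congr rfl fun j _ => by ring

/-- Convexity in the state variable of `ρ ↦ Σ_{k,l} ĉ(λ_k,λ_l)·|⟨u_k, A u_l⟩|²` (and hence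
of the metric adjusted skew information) for `f ∈ F_op` with Morozova-Chentsov function `c`. -/
theorem skewSum_convex {n : ℕ} (f : ℝ → ℝ)
    (hf_mono : OperatorMonotone f) (hf_pos : ∀ t > 0, 0 < f t)
    (hf_symm : ∀ t > 0, f t = t * f (1 / t)) (hf_one : f 1 = 1)
    (A : Matrix (Fin n) (Fin n) ℂ) (hA : A.IsHermitian)
    (ρ σ : Matrix (Fin n) (Fin n) ℂ) (hρ : ρ.PosDef) (hσ : σ.PosDef)
    (hρtr : ρ.trace = 1) (hσtr : σ.trace = 1)
    (t : ℝ) (ht0 : 0 ≤ t) (ht1 : t ≤ 1) :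
    skewSum f (t • ρ + (1 - t) • σ) A ≤ t * skewSum f ρ A + (1 - t) * skewSum f σ A := by
  obtain ⟨U₁, hU₁, -, ha₁, hb₁, hS₁⟩ := exists_unitary_kronecker hρ
  obtain ⟨U₂, hU₂, -, ha₂, hb₂, hS₂⟩ := exists_unitary_kronecker hσ
  have hτ : (t • ρ + (1 - t) • σ).PosDef := by
    rcases ht0.eq_or_lt with rfl | ht
    · simpa using hσ
    · exact (hρ.smul ht).add_posSemidef (hσ.posSemidef.smul (sub_nonneg.mpr ht1))
  obtain ⟨U, hU, hU', ha, hb, hS⟩ := exists_unitary_kronecker hτ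
  rw [hS, hS₁, hS₂]
  have hsplit : t • ρ + (1 - t) • σ = (t : ℂ) • ρ + ((1 - t : ℝ) : ℂ) • σ := by
    rw [Complex.coe_smul, Complex.coe_smul]
  refine diagForm_chat_convex hf_mono hf_pos hf_symm ht0 (sub_nonneg.mpr ht1) hU hU'
    (fun p => hτ.eigenvalues_pos p.1) (fun p => hτ.eigenvalues_pos p.2)
    (fun p => hρ.eigenvalues_pos p.1) (fun p => hρ.eigenvalues_pos p.2)
    (fun p => hσ.eigenvalues_pos p.1) (fun p => hσ.eigenvalues_pos p.2) ?_ ?_ _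
  · rw [ha, ha₁, ha₂, hsplit, add_kronecker, smul_kronecker, smul_kronecker]
  · rw [hb, hb₁, hb₂, hsplit, transpose_add, transpose_smul, transpose_smul, kronecker_add,
      kronecker_smul, kronecker_smul]
end

section
/- Let f be a regular function in F_op with Morozova-Chentsov function c, let ρ be a positive definite bipartite density matrix on ℂ^n ⊗ ℂ^m with partial trace ρ₁ = Tr₂ρ, and let A be an n×n complex Hermitian matrix. Then I^c_ρ(A ⊗ 1₂) ≥ I^c_{ρ₁}(A). -/
open Matrix Kronecker ComplexOrder

/-- The metric adjusted skew information
`I^c_ρ(A) = (f(0)/2)·Σ_{k,l} ĉ(λ_k,λ_l)·|⟨u_k, A u_l⟩|²`. -/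
noncomputable def Ic {ι : Type} [Fintype ι] [DecidableEq ι] (f : ℝ → ℝ)
    (ρ A : Matrix ι ι ℂ) : ℝ :=
  (f 0 / 2) * skewSum f ρ A

/-- Partial trace over the second factor. -/
noncomputable def ptrace2 {n m : ℕ} (ρ : Matrix (Fin n × Fin m) (Fin n × Fin m) ℂ) :
    Matrix (Fin n) (Fin n) ℂ :=
  Matrix.of fun i i' => ∑ j, ρ (i, j) (i', j)

/-- Partial trace over the first factor. -/
noncomputable def ptrace1 {n m : ℕ} (ρ : Matrix (Fin n × Fin m) (Fin n × Fin m) ℂ) :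
    Matrix (Fin m) (Fin m) ℂ :=
  Matrix.of fun j j' => ∑ i, ρ (i, j) (i, j')

theorem matFun_eq {ι : Type} [Fintype ι] [DecidableEq ι] (g : ℝ → ℝ)
    {M : Matrix ι ι ℂ} (hM : M.IsHermitian) :
    matFun g M = (hM.eigenvectorUnitary : Matrix ι ι ℂ) *
      diagonal (fun i => (g (hM.eigenvalues i) : ℂ)) *
      (hM.eigenvectorUnitary : Matrix ι ι ℂ)ᴴ := by
  ext a b
  rw [Matrix.mul_apply]
  simp only [matFun, dif_pos hM, Matrix.sum_apply, Matrix.smul_apply, vecMulVec_apply,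
    mul_diagonal, conjTranspose_apply, IsHermitian.eigenvectorUnitary_apply,
    Pi.star_apply, smul_eq_mul]
  exact Finset.sum_congr rfl fun i _ => by ring

theorem isHermitian_spectral {ι : Type} [Fintype ι] [DecidableEq ι]
    {M : Matrix ι ι ℂ} (hM : M.IsHermitian) :
    M = (hM.eigenvectorUnitary : Matrix ι ι ℂ) *
      diagonal (fun i => (hM.eigenvalues i : ℂ)) *
      (hM.eigenvectorUnitary : Matrix ι ι ℂ)ᴴ := by
  conv_lhs => rw [hM.spectral_theorem]
  rfl

theorem eigenvectorUnitary_conj_mul {ι : Type} [Fintype ι] [DecidableEq ι]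
    {M : Matrix ι ι ℂ} (hM : M.IsHermitian) :
    (hM.eigenvectorUnitary : Matrix ι ι ℂ)ᴴ * (hM.eigenvectorUnitary : Matrix ι ι ℂ) = 1 :=
  Unitary.coe_star_mul_self hM.eigenvectorUnitary

theorem eigenvectorUnitary_mul_conj {ι : Type} [Fintype ι] [DecidableEq ι]
    {M : Matrix ι ι ℂ} (hM : M.IsHermitian) :
    (hM.eigenvectorUnitary : Matrix ι ι ℂ) * (hM.eigenvectorUnitary : Matrix ι ι ℂ)ᴴ = 1 :=
  Unitary.coe_mul_star_self hM.eigenvectorUnitary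

theorem matFun_mulVec_of_eigenvector {ι : Type} [Fintype ι] [DecidableEq ι] (g : ℝ → ℝ)
    {M : Matrix ι ι ℂ} (hM : M.IsHermitian) {v : ι → ℂ} {c : ℝ} (hv : M *ᵥ v = (c : ℂ) • v) :
    matFun g M *ᵥ v = (g c : ℂ) • v := by
  set U : Matrix ι ι ℂ := ↑hM.eigenvectorUnitary with hU
  have h1 : Uᴴ * U = 1 := eigenvectorUnitary_conj_mul hM
  have h2 : U * Uᴴ = 1 := eigenvectorUnitary_mul_conj hM
  have hy : diagonal (fun i => (hM.eigenvalues i : ℂ)) *ᵥ (Uᴴ *ᵥ v) = (c : ℂ) • (Uᴴ *ᵥ v) := by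
    rw [← mulVec_smul, ← hv, mulVec_mulVec, mulVec_mulVec]
    conv_rhs => rw [isHermitian_spectral hM, ← hU]
    rw [← Matrix.mul_assoc, ← Matrix.mul_assoc, h1, Matrix.one_mul]
  have hg : diagonal (fun i => (g (hM.eigenvalues i) : ℂ)) *ᵥ (Uᴴ *ᵥ v) =
      (g c : ℂ) • (Uᴴ *ᵥ v) := by
    ext i
    have := congrFun hy i
    simp only [mulVec_diagonal, Pi.smul_apply, smul_eq_mul] at this ⊢
    by_cases h : (Uᴴ *ᵥ v) i = 0
    · rw [h, mul_zero, mul_zero]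
    · have := mul_right_cancel₀ h this
      rw [Complex.ofReal_injective this]
  rw [matFun_eq g hM, ← hU, ← mulVec_mulVec, ← mulVec_mulVec, hg, mulVec_smul, mulVec_mulVec, h2,
    one_mulVec]

theorem skewSum_eq {ι : Type} [Fintype ι] [DecidableEq ι] (f : ℝ → ℝ)
    {ρ : Matrix ι ι ℂ} (hρ : ρ.IsHermitian) (A : Matrix ι ι ℂ) :
    skewSum f ρ A = ∑ i, ∑ j, chat f (hρ.eigenvalues i) (hρ.eigenvalues j) *
      Complex.normSq (((hρ.eigenvectorUnitary : Matrix ι ι ℂ)ᴴ * A *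
        (hρ.eigenvectorUnitary : Matrix ι ι ℂ)) i j) := by
  rw [skewSum, dif_pos hρ]
  refine Finset.sum_congr rfl fun i _ => Finset.sum_congr rfl fun j _ => ?_
  congr 2
  rw [Matrix.mul_assoc]
  rfl

theorem OperatorMonotone.monotone {g : ℝ → ℝ} (hg : OperatorMonotone g) {x y : ℝ} (hx : 0 < x)
    (hxy : x ≤ y) : g x ≤ g y := by
  have hd (z : ℝ) : (diagonal fun _ : Fin 1 => (z : ℂ)) *ᵥ (1 : Fin 1 → ℂ) = (z : ℂ) • 1 := by
    ext i; simp [mulVec_diagonal]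
  have hh (z : ℝ) : (diagonal fun _ : Fin 1 => (z : ℂ)).IsHermitian := by
    rw [isHermitian_diagonal_iff]; intro i; simp [isSelfAdjoint_iff]
  have hp {z : ℝ} (hz : 0 < z) : (diagonal fun _ : Fin 1 => (z : ℂ)).PosDef := by
    rw [posDef_diagonal_iff]; intro i; exact_mod_cast hz
  have h := hg 1 (diagonal fun _ => (x : ℂ)) (diagonal fun _ => (y : ℂ)) (hp hx)
    (hp (hx.trans_le hxy)) (by
      rw [diagonal_sub, posSemidef_diagonal_iff]; intro i
      rw [← Complex.ofReal_sub]; exact_mod_cast sub_nonneg.2 hxy)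
  have h := h.dotProduct_mulVec_nonneg 1
  rw [sub_mulVec, matFun_mulVec_of_eigenvector g (hh y) (hd y),
    matFun_mulVec_of_eigenvector g (hh x) (hd x)] at h
  simp only [star_one, ← sub_smul, dotProduct_smul] at h
  simp at h
  exact_mod_cast h

theorem OperatorMonotone.mul_le {f : ℝ → ℝ} (hf : OperatorMonotone f)
    (hf_symm : ∀ t > 0, f t = t * f (1 / t)) {s t : ℝ} (hs : 1 ≤ s) (ht : 0 < t) :
    f (s * t) ≤ s * f t := by
  have hs0 : 0 < s := by linarith
  rw [hf_symm (s * t) (by positivity), hf_symm t ht, ← mul_assoc]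
  gcongr
  exact hf.monotone (by positivity) (by gcongr; nlinarith)

theorem matFun_mul_of_mul_diagonal {ι κ : Type} [Fintype ι] [DecidableEq ι] [Fintype κ]
    [DecidableEq κ] (g : ℝ → ℝ) {M : Matrix ι ι ℂ} (hM : M.IsHermitian) {V : Matrix ι κ ℂ}
    {c : κ → ℝ} (hV : M * V = V * diagonal fun q => (c q : ℂ)) :
    matFun g M * V = V * diagonal fun q => (g (c q) : ℂ) := by
  ext p q
  have h : M *ᵥ V.col q = (c q : ℂ) • V.col q := by
    ext p
    have := congrFun (congrFun hV p) q
    rw [mul_diagonal, mul_comm] at this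
    exact this
  have := congrFun (matFun_mulVec_of_eigenvector g hM h) p
  rw [mul_diagonal, mul_comm]
  exact this

theorem isHermitian_diagonal_ofReal {ι : Type} [DecidableEq ι] (d : ι → ℝ) :
    (diagonal fun i => (d i : ℂ)).IsHermitian := by
  rw [isHermitian_diagonal_iff]
  intro i
  simp [isSelfAdjoint_iff]

theorem matFun_diagonal {ι : Type} [Fintype ι] [DecidableEq ι] (g : ℝ → ℝ) (d : ι → ℝ) :
    matFun g (diagonal fun i => (d i : ℂ)) = diagonal fun i => (g (d i) : ℂ) := by
  simpa using matFun_mul_of_mul_diagonal g (isHermitian_diagonal_ofReal d) (V := 1) (c := d)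
    (by simp)

theorem star_dotProduct_diagonal_mulVec {ι : Type} [Fintype ι] [DecidableEq ι] (c : ι → ℝ)
    (x : ι → ℂ) :
    star x ⬝ᵥ (diagonal fun i => (c i : ℂ)) *ᵥ x = ((∑ i, c i * Complex.normSq (x i) : ℝ) : ℂ) := by
  simp only [dotProduct, mulVec_diagonal, Pi.star_apply, Complex.ofReal_sum, Complex.ofReal_mul,
    Complex.normSq_eq_conj_mul_self, Complex.star_def]
  exact Finset.sum_congr rfl fun i _ => by ring

/-- For an isometry `V`, a diagonal matrix `D` is dominated by
`(1 + a²) V (Vᴴ D V) Vᴴ + b (1 - V Vᴴ)` when `b` is large. -/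
theorem posSemidef_dilation_sub {ι κ : Type} [Fintype ι] [DecidableEq ι] [Fintype κ]
    [DecidableEq κ] {V : Matrix ι κ ℂ} {d : ι → ℝ} (hd : ∀ i, 0 < d i) (hV : Vᴴ * V = 1)
    {a b : ℝ} (ha : 0 < a) (hb : ∀ i, (1 + (a ^ 2)⁻¹) * d i ≤ b) :
    ((1 + a ^ 2) • (V * (Vᴴ * (diagonal fun i => (d i : ℂ)) * V) * Vᴴ) + b • (1 - V * Vᴴ) -
      diagonal fun i => (d i : ℂ)).PosSemidef := by
  set D : Matrix ι ι ℂ := diagonal fun i => (d i : ℂ) with hD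
  set P : Matrix ι ι ℂ := V * Vᴴ with hP
  set R : Matrix ι ι ℂ := 1 - P with hR
  have hPP : P * P = P := by
    rw [hP, Matrix.mul_assoc, ← Matrix.mul_assoc Vᴴ, hV, Matrix.one_mul]
  have hPh : Pᴴ = P := by simp [hP]
  have hRh : Rᴴ = R := by simp [hR, hPh]
  have hRR : R * R = R := by
    rw [hR, Matrix.mul_sub, Matrix.sub_mul, Matrix.sub_mul, hPP]; simp
  have hDpos : D.PosSemidef := by
    rw [hD, posSemidef_diagonal_iff]; intro i; exact_mod_cast (hd i).le
  have hGpos : (b • (1 : Matrix ι ι ℂ) - (1 + (a ^ 2)⁻¹) • D).PosSemidef := by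
    have : b • (1 : Matrix ι ι ℂ) - (1 + (a ^ 2)⁻¹) • D =
        diagonal fun i => ((b - (1 + (a ^ 2)⁻¹) * d i : ℝ) : ℂ) := by
      ext i j
      by_cases h : i = j
      · subst h; simp [hD]
      · simp [hD, h]
    rw [this, posSemidef_diagonal_iff]
    intro i
    exact_mod_cast sub_nonneg.2 (hb i)
  have h1 := (hDpos.conjTranspose_mul_mul_same (a • P - a⁻¹ • R)).add
    (hGpos.conjTranspose_mul_mul_same R)
  convert h1 using 1
  have e1 : V * (Vᴴ * D * V) * Vᴴ = P * D * P := by simp only [hP, Matrix.mul_assoc]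
  have e2 : D = P * D * P + P * D * R + R * D * P + R * D * R := by
    rw [hR]; noncomm_ring
  have e3 : (a • P - a⁻¹ • R)ᴴ = a • P - a⁻¹ • R := by
    simp [conjTranspose_sub, conjTranspose_smul, hPh, hRh]
  rw [e1, e3, hRh]
  nth_rewrite 2 [e2]
  simp only [Matrix.mul_sub, Matrix.sub_mul, Matrix.mul_smul, Matrix.smul_mul, Matrix.mul_one,
    smul_sub, smul_smul, hRR]
  match_scalars <;> field_simp <;> ring

/-- Jensen's operator inequality for an isometry, in the case where both operators are diagonal. -/
theorem OperatorMonotone.sum_le_sum_of_isometry {k : ℕ} {κ : Type} [Fintype κ] [DecidableEq κ]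
    {f : ℝ → ℝ} (hf : OperatorMonotone f) (hf_pos : ∀ t > 0, 0 < f t)
    (hf_symm : ∀ t > 0, f t = t * f (1 / t)) {V : Matrix (Fin k) κ ℂ} {d : Fin k → ℝ} {e : κ → ℝ}
    (hd : ∀ p, 0 < d p) (he : ∀ q, 0 < e q) (hV : Vᴴ * V = 1)
    (hVd : Vᴴ * (diagonal fun p => (d p : ℂ)) * V = diagonal fun q => (e q : ℂ)) (x : κ → ℂ) :
    ∑ p, f (d p) * Complex.normSq ((V *ᵥ x) p) ≤ ∑ q, f (e q) * Complex.normSq (x q) := by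
  have hnonneg : 0 ≤ ∑ q, f (e q) * Complex.normSq (x q) :=
    Finset.sum_nonneg fun q _ => mul_nonneg (hf_pos _ (he q)).le (Complex.normSq_nonneg _)
  rw [le_iff_forall_one_lt_le_mul₀ hnonneg]
  intro s hs
  set a := √(s - 1) with ha
  have ha2 : 1 + a ^ 2 = s := by rw [ha, Real.sq_sqrt (by linarith)]; ring
  have ha0 : 0 < a := Real.sqrt_pos.2 (by linarith)
  obtain ⟨b, hb⟩ : ∃ b, ∀ p, (1 + (a ^ 2)⁻¹) * d p ≤ b := by
    refine ⟨∑ p, (1 + (a ^ 2)⁻¹) * d p, fun p => ?_⟩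
    exact Finset.single_le_sum (f := fun p => (1 + (a ^ 2)⁻¹) * d p)
      (fun i _ => mul_nonneg (by positivity) (hd i).le) (Finset.mem_univ p)
  have hM := posSemidef_dilation_sub hd hV ha0 hb
  rw [hVd, ha2] at hM
  set D : Matrix (Fin k) (Fin k) ℂ := diagonal fun p => (d p : ℂ) with hD
  set M := s • (V * (diagonal fun q => (e q : ℂ)) * Vᴴ) + b • (1 - V * Vᴴ) with hMdef
  have hDpos : D.PosDef := by
    rw [hD, posDef_diagonal_iff]; intro p; exact_mod_cast hd p
  have hMpos : M.PosDef := by simpa using hDpos.add_posSemidef hM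
  have hMV : M * V = V * diagonal fun q => ((s * e q : ℝ) : ℂ) := by
    have h1 : (1 - V * Vᴴ) * V = 0 := by
      rw [Matrix.sub_mul, Matrix.mul_assoc, hV]; simp
    rw [hMdef, Matrix.add_mul, Matrix.smul_mul, Matrix.smul_mul, h1, Matrix.mul_assoc, hV]
    ext p q
    simp
    ring
  have h := (hf k D M hDpos hMpos hM).dotProduct_mulVec_nonneg (V *ᵥ x)
  have h2 : star (V *ᵥ x) ⬝ᵥ matFun f M *ᵥ (V *ᵥ x) =
      star x ⬝ᵥ (diagonal fun q => (f (s * e q) : ℂ)) *ᵥ x := by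
    rw [mulVec_mulVec, matFun_mul_of_mul_diagonal f hMpos.1 hMV, star_mulVec, dotProduct_mulVec,
      vecMul_vecMul, ← Matrix.mul_assoc, hV, Matrix.one_mul, dotProduct_mulVec]
  rw [sub_mulVec, dotProduct_sub, h2, hD, matFun_diagonal, star_dotProduct_diagonal_mulVec,
    star_dotProduct_diagonal_mulVec, sub_nonneg, Complex.real_le_real] at h
  refine h.trans ?_
  rw [mul_comm, Finset.mul_sum]
  refine Finset.sum_le_sum fun q _ => ?_
  rw [← mul_assoc]
  exact mul_le_mul_of_nonneg_right (hf.mul_le hf_symm hs.le (he q)) (Complex.normSq_nonneg _)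

theorem OperatorMonotone.sum_le_sum_of_linear_isometry {ι κ : Type} [Fintype ι] [Fintype κ]
    [DecidableEq κ] {f : ℝ → ℝ} (hf : OperatorMonotone f) (hf_pos : ∀ t > 0, 0 < f t)
    (hf_symm : ∀ t > 0, f t = t * f (1 / t)) (T : (κ → ℂ) →ₗ[ℂ] (ι → ℂ)) {d : ι → ℝ} {e : κ → ℝ}
    (hd : ∀ p, 0 < d p) (he : ∀ q, 0 < e q)
    (hT : ∀ x y, ∑ p, star (T x p) * T y p = ∑ q, star (x q) * y q)
    (hTd : ∀ x y, ∑ p, star (T x p) * d p * T y p = ∑ q, star (x q) * e q * y q) (x : κ → ℂ) :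
    ∑ p, f (d p) * Complex.normSq (T x p) ≤ ∑ q, f (e q) * Complex.normSq (x q) := by
  let φ := (Fintype.equivFin ι).symm
  set V : Matrix (Fin (Fintype.card ι)) κ ℂ := (LinearMap.toMatrix' T).submatrix φ id with hVdef
  have hVx (x : κ → ℂ) (p) : (V *ᵥ x) p = T x (φ p) :=
    congrFun (LinearMap.toMatrix'_mulVec T x) (φ p)
  have hVq (p q) : V p q = T (Pi.single q 1) (φ p) := by
    simp [hVdef, LinearMap.toMatrix'_apply]
  have key := hf.sum_le_sum_of_isometry hf_pos hf_symm (V := V) (d := d ∘ φ) (e := e)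
    (fun p => hd _) he ?_ ?_ x
  · simp only [hVx] at key
    rwa [← Equiv.sum_comp φ]
  · ext q q'
    rw [Matrix.mul_apply]
    simp only [conjTranspose_apply, hVq]
    rw [Equiv.sum_comp φ (fun p => star (T (Pi.single q 1) p) * T (Pi.single q' 1) p), hT]
    simp [Pi.single_apply, Matrix.one_apply, apply_ite, eq_comm]
  · ext q q'
    rw [Matrix.mul_apply]
    simp only [conjTranspose_apply, hVq, mul_diagonal, Function.comp_apply]
    rw [Equiv.sum_comp φ (fun p => star (T (Pi.single q 1) p) * d p * T (Pi.single q' 1) p), hTd]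
    by_cases h : q = q'
    · subst h; simp [Pi.single_apply]
    · simp [Pi.single_apply, h, Ne.symm h]

theorem OperatorMonotone.sum_mean_le {ι κ : Type} [Fintype ι] [Fintype κ] [DecidableEq κ]
    {f : ℝ → ℝ} (hf : OperatorMonotone f) (hf_pos : ∀ t > 0, 0 < f t)
    (hf_symm : ∀ t > 0, f t = t * f (1 / t)) (Φ : Matrix κ κ ℂ →ₗ[ℂ] Matrix ι ι ℂ)
    {l : ι → ℝ} {m : κ → ℝ} (hl : ∀ p, 0 < l p) (hm : ∀ q, 0 < m q)
    (hright : ∀ X Y, ∑ i, ∑ j, star (Φ X i j) * l j * Φ Y i j =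
      ∑ i, ∑ j, star (X i j) * m j * Y i j)
    (hleft : ∀ X Y, ∑ i, ∑ j, star (Φ X i j) * l i * Φ Y i j =
      ∑ i, ∑ j, star (X i j) * m i * Y i j) (X : Matrix κ κ ℂ) :
    ∑ i, ∑ j, l j * f (l i / l j) * Complex.normSq (Φ X i j) ≤
      ∑ i, ∑ j, m j * f (m i / m j) * Complex.normSq (X i j) := by
  have hl' (p) : (l p : ℂ) ≠ 0 := by exact_mod_cast (hl p).ne'
  have hm' (p) : (m p : ℂ) ≠ 0 := by exact_mod_cast (hm p).ne'
  have hls (p) : ((√(l p) : ℝ) : ℂ) * (√(l p) : ℝ) = l p := by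
    rw [← Complex.ofReal_mul, Real.mul_self_sqrt (hl p).le]
  have hms (p) : ((√(m p) : ℝ) : ℂ) * (√(m p) : ℝ) = m p := by
    rw [← Complex.ofReal_mul, Real.mul_self_sqrt (hm p).le]
  have hmr (p) : ((√(m p) : ℝ) : ℂ) ≠ 0 := by
    exact_mod_cast (Real.sqrt_pos.2 (hm p)).ne'
  let S : (κ × κ → ℂ) →ₗ[ℂ] Matrix κ κ ℂ :=
    { toFun := fun x => Matrix.of fun i j => x (i, j) * ((√(m j) : ℝ) : ℂ)⁻¹
      map_add' := fun x y => by ext i j; simp [add_mul]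
      map_smul' := fun c x => by ext i j; simp [mul_assoc] }
  let T : (κ × κ → ℂ) →ₗ[ℂ] (ι × ι → ℂ) :=
    { toFun := fun x p => ((√(l p.2) : ℝ) : ℂ) * Φ (S x) p.1 p.2
      map_add' := fun x y => by ext p; simp [mul_add]
      map_smul' := fun c x => by ext p; simp; ring }
  have hT (x i j) : T x (i, j) = ((√(l j) : ℝ) : ℂ) * Φ (S x) i j := rfl
  have hS (x i j) : x (i, j) = S x i j * ((√(m j) : ℝ) : ℂ) := by
    change _ = x (i, j) * ((√(m j) : ℝ) : ℂ)⁻¹ * _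
    rw [mul_assoc, inv_mul_cancel₀ (hmr j), mul_one]
  have key := hf.sum_le_sum_of_linear_isometry hf_pos hf_symm T
    (d := fun p => l p.1 / l p.2) (e := fun q => m q.1 / m q.2)
    (fun p => div_pos (hl _) (hl _)) (fun q => div_pos (hm _) (hm _)) ?_ ?_
    (fun q => X q.1 q.2 * (√(m q.2) : ℝ))
  · have hSX : S (fun q => X q.1 q.2 * (√(m q.2) : ℝ)) = X := by
      ext i j
      exact (mul_right_cancel₀ (hmr j) (hS (fun q => X q.1 q.2 * (√(m q.2) : ℝ)) i j)).symm
    simp only [Fintype.sum_prod_type, hT, hSX, Complex.normSq_mul, Complex.normSq_ofReal,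
      Real.mul_self_sqrt (hl _).le, Real.mul_self_sqrt (hm _).le] at key
    refine Eq.trans_le ?_ (key.trans_eq ?_) <;>
      exact Finset.sum_congr rfl fun i _ => Finset.sum_congr rfl fun j _ => by ring
  · intro x y
    simp only [Fintype.sum_prod_type, hT]
    refine Eq.trans ?_ ((hright (S x) (S y)).trans ?_) <;>
      refine Finset.sum_congr rfl fun i _ => Finset.sum_congr rfl fun j _ => ?_
    · simp only [star_mul', Complex.star_def, Complex.conj_ofReal, ← hls]
      ring
    · simp only [hS _ i j, star_mul', Complex.star_def, Complex.conj_ofReal, ← hms]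
      ring
  · intro x y
    simp only [Fintype.sum_prod_type, hT]
    refine Eq.trans ?_ ((hleft (S x) (S y)).trans ?_) <;>
      refine Finset.sum_congr rfl fun i _ => Finset.sum_congr rfl fun j _ => ?_
    · simp only [star_mul', Complex.star_def, Complex.conj_ofReal, Complex.ofReal_div]
      have h := div_mul_cancel₀ (l i : ℂ) (hl' j)
      linear_combination (starRingEnd ℂ (Φ (S x) i j)) * Φ (S y) i j *
        ((l i / l j : ℂ) * hls j + h)
    · have h := div_mul_cancel₀ (m i : ℂ) (hm' j)
      simp only [hS _ i j, star_mul', Complex.star_def, Complex.conj_ofReal, Complex.ofReal_div]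
      linear_combination -(starRingEnd ℂ (S x i j)) * S y i j *
        ((m i / m j : ℂ) * hms j + h)

/-- The monotone metric associated with `f` contracts, written for commutators
`[ρ, A]` in eigenbases. -/
theorem OperatorMonotone.sum_chat_le {ι κ : Type} [Fintype ι] [Fintype κ] [DecidableEq κ]
    {f : ℝ → ℝ} (hf : OperatorMonotone f) (hf_pos : ∀ t > 0, 0 < f t)
    (hf_symm : ∀ t > 0, f t = t * f (1 / t)) (Φ : Matrix κ κ ℂ →ₗ[ℂ] Matrix ι ι ℂ)
    {l : ι → ℝ} {m : κ → ℝ} (hl : ∀ p, 0 < l p) (hm : ∀ q, 0 < m q)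
    (hright : ∀ X Y, ∑ i, ∑ j, star (Φ X i j) * l j * Φ Y i j =
      ∑ i, ∑ j, star (X i j) * m j * Y i j)
    (hleft : ∀ X Y, ∑ i, ∑ j, star (Φ X i j) * l i * Φ Y i j =
      ∑ i, ∑ j, star (X i j) * m i * Y i j) (A : Matrix κ κ ℂ) :
    ∑ i, ∑ j, chat f (m i) (m j) * Complex.normSq (A i j) ≤
      ∑ i, ∑ j, chat f (l i) (l j) * Complex.normSq (Φ A i j) := by
  have hlf (i j) : 0 < l j * f (l i / l j) := mul_pos (hl _) (hf_pos _ (div_pos (hl _) (hl _)))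
  have hmf (i j) : 0 < m j * f (m i / m j) := mul_pos (hm _) (hf_pos _ (div_pos (hm _) (hm _)))
  set X : Matrix κ κ ℂ :=
    Matrix.of fun i j => (((m i - m j) / (m j * f (m i / m j)) : ℝ) : ℂ) * A i j with hX
  have hXX := hf.sum_mean_le hf_pos hf_symm Φ hl hm hright hleft X
  have h1 : ∑ i, ∑ j, m j * f (m i / m j) * Complex.normSq (X i j) =
      ∑ i, ∑ j, chat f (m i) (m j) * Complex.normSq (A i j) := by
    refine Finset.sum_congr rfl fun i _ => Finset.sum_congr rfl fun j _ => ?_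
    have := (hmf i j).ne'
    rw [hX, of_apply, Complex.normSq_mul, Complex.normSq_ofReal, chat]
    generalize m j * f (m i / m j) = c at *
    field_simp
  have h2 : ((∑ i, ∑ j, chat f (m i) (m j) * Complex.normSq (A i j) : ℝ) : ℂ) =
      ∑ i, ∑ j, star (Φ X i j) * ((l i - l j : ℝ) : ℂ) * Φ A i j := by
    have h3 : ∑ i, ∑ j, star (Φ X i j) * ((l i - l j : ℝ) : ℂ) * Φ A i j =
        ∑ i, ∑ j, star (X i j) * ((m i - m j : ℝ) : ℂ) * A i j := by
      simp only [Complex.ofReal_sub, mul_sub, sub_mul, Finset.sum_sub_distrib, hleft, hright]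
    rw [h3]
    push_cast
    refine Finset.sum_congr rfl fun i _ => Finset.sum_congr rfl fun j _ => ?_
    rw [hX, of_apply, chat, Complex.normSq_eq_conj_mul_self, star_mul', Complex.star_def,
      Complex.conj_ofReal]
    push_cast
    ring
  have h4 : ∑ i, ∑ j, chat f (m i) (m j) * Complex.normSq (A i j) ≤
      ∑ i, ∑ j, (l j * f (l i / l j) * Complex.normSq (Φ X i j) +
        chat f (l i) (l j) * Complex.normSq (Φ A i j)) / 2 := by
    rw [← Complex.ofReal_re (∑ i, ∑ j, chat f (m i) (m j) * Complex.normSq (A i j)), h2]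
    simp only [Complex.re_sum]
    refine Finset.sum_le_sum fun i _ => Finset.sum_le_sum fun j _ => ?_
    rw [chat]
    have hc := hlf i j
    generalize l j * f (l i / l j) = c at *
    generalize Φ X i j = u
    generalize Φ A i j = v
    generalize l i - l j = d
    have hu : 0 ≤ Complex.normSq ((c : ℂ) * u - d * v) / c :=
      div_nonneg (Complex.normSq_nonneg _) hc.le
    have : Complex.normSq ((c : ℂ) * u - d * v) / c = c * Complex.normSq u +
        d ^ 2 * (1 / c) * Complex.normSq v - 2 * (star u * d * v).re := by
      simp [Complex.normSq_apply]
      field_simp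
      ring
    linarith
  simp only [← Finset.sum_div, Finset.sum_add_distrib] at h4
  linarith

theorem trace_kronecker_one_mul {n m : ℕ} (Z : Matrix (Fin n) (Fin n) ℂ)
    (ρ : Matrix (Fin n × Fin m) (Fin n × Fin m) ℂ) :
    ((Z ⊗ₖ (1 : Matrix (Fin m) (Fin m) ℂ)) * ρ).trace = (Z * ptrace2 ρ).trace := by
  simp only [trace, diag_apply, Matrix.mul_apply, Fintype.sum_prod_type, kroneckerMap_apply,
    ptrace2, of_apply, Finset.mul_sum, one_apply, mul_ite, mul_one, mul_zero, ite_mul, zero_mul,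
    Finset.sum_ite_eq, Finset.mem_univ, if_true]
  exact Finset.sum_congr rfl fun i _ => Finset.sum_comm

theorem posDef_ptrace2 {n m : ℕ} [Nonempty (Fin m)]
    {ρ : Matrix (Fin n × Fin m) (Fin n × Fin m) ℂ} (hρ : ρ.PosDef) : (ptrace2 ρ).PosDef := by
  have h : ptrace2 ρ = ∑ j, ρ.submatrix (fun i => (i, j)) fun i => (i, j) := by
    ext i i'
    simp [ptrace2, Matrix.sum_apply]
  rw [h]
  exact posDef_sum Finset.univ_nonempty fun j _ =>
    hρ.submatrix fun a b hab => congrArg Prod.fst hab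

theorem sum_star_mul_mul_right {ι : Type} [Fintype ι] [DecidableEq ι] (X Y : Matrix ι ι ℂ)
    (d : ι → ℝ) : ∑ i, ∑ j, star (X i j) * d j * Y i j =
      (Xᴴ * Y * diagonal fun i => (d i : ℂ)).trace := by
  rw [Finset.sum_comm]
  simp only [trace, diag_apply, mul_diagonal]
  simp only [Matrix.mul_apply, conjTranspose_apply, Finset.sum_mul]
  exact Finset.sum_congr rfl fun i _ => Finset.sum_congr rfl fun j _ => by ring

theorem sum_star_mul_mul_left {ι : Type} [Fintype ι] [DecidableEq ι] (X Y : Matrix ι ι ℂ)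
    (d : ι → ℝ) : ∑ i, ∑ j, star (X i j) * d i * Y i j =
      (Y * Xᴴ * diagonal fun i => (d i : ℂ)).trace := by
  simp only [trace, diag_apply, mul_diagonal]
  simp only [Matrix.mul_apply, conjTranspose_apply, Finset.sum_mul]
  exact Finset.sum_congr rfl fun i _ => Finset.sum_congr rfl fun j _ => by ring

/-- `Y ↦ Uᴴ (W Y Wᴴ ⊗ 1) U`: ampliation, read in the bases given by the columns of `W` and `U`. -/
noncomputable def ampliation {n m : ℕ} (U : Matrix (Fin n × Fin m) (Fin n × Fin m) ℂ)
    (W : Matrix (Fin n) (Fin n) ℂ) :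
    Matrix (Fin n) (Fin n) ℂ →ₗ[ℂ] Matrix (Fin n × Fin m) (Fin n × Fin m) ℂ where
  toFun Y := Uᴴ * ((W * Y * Wᴴ) ⊗ₖ (1 : Matrix (Fin m) (Fin m) ℂ)) * U
  map_add' X Y := by simp only [Matrix.mul_add, Matrix.add_mul, add_kronecker]
  map_smul' c X := by
    simp only [Matrix.mul_smul, Matrix.smul_mul, smul_kronecker, RingHom.id_apply]

theorem ampliation_apply {n m : ℕ} (U : Matrix (Fin n × Fin m) (Fin n × Fin m) ℂ)
    (W Y : Matrix (Fin n) (Fin n) ℂ) :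
    ampliation U W Y = Uᴴ * ((W * Y * Wᴴ) ⊗ₖ (1 : Matrix (Fin m) (Fin m) ℂ)) * U := rfl

theorem ampliation_conjTranspose {n m : ℕ} (U : Matrix (Fin n × Fin m) (Fin n × Fin m) ℂ)
    (W Y : Matrix (Fin n) (Fin n) ℂ) : (ampliation U W Y)ᴴ = ampliation U W Yᴴ := by
  simp [ampliation_apply, conjTranspose_kronecker, Matrix.mul_assoc]

theorem ampliation_mul {n m : ℕ} {U : Matrix (Fin n × Fin m) (Fin n × Fin m) ℂ}
    {W : Matrix (Fin n) (Fin n) ℂ} (hU : U * Uᴴ = 1) (hW : Wᴴ * W = 1)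
    (X Y : Matrix (Fin n) (Fin n) ℂ) :
    ampliation U W X * ampliation U W Y = ampliation U W (X * Y) := by
  have h1 : W * (X * Y) * Wᴴ = (W * X * Wᴴ) * (W * Y * Wᴴ) := by
    simp only [Matrix.mul_assoc]
    rw [← Matrix.mul_assoc Wᴴ W, hW, Matrix.one_mul]
  have h2 := mul_kronecker_mul (W * X * Wᴴ) (W * Y * Wᴴ) (1 : Matrix (Fin m) (Fin m) ℂ)
    (1 : Matrix (Fin m) (Fin m) ℂ)
  rw [Matrix.one_mul] at h2
  simp only [ampliation_apply]
  rw [h1, h2]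
  simp only [Matrix.mul_assoc]
  rw [← Matrix.mul_assoc U Uᴴ, hU, Matrix.one_mul]

theorem trace_ampliation_mul {n m : ℕ} {U L : Matrix (Fin n × Fin m) (Fin n × Fin m) ℂ}
    {W M : Matrix (Fin n) (Fin n) ℂ} (hW : Wᴴ * W = 1)
    (h : ptrace2 (U * L * Uᴴ) = W * M * Wᴴ) (Z : Matrix (Fin n) (Fin n) ℂ) :
    (ampliation U W Z * L).trace = (Z * M).trace := by
  rw [ampliation_apply, Matrix.mul_assoc, Matrix.mul_assoc, trace_mul_comm, Matrix.mul_assoc,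
    trace_kronecker_one_mul, h, trace_mul_comm]
  simp only [Matrix.mul_assoc]
  rw [← Matrix.mul_assoc Wᴴ W, hW, Matrix.one_mul, trace_mul_comm, trace_mul_comm Z]
  simp only [Matrix.mul_assoc, hW, Matrix.mul_one]

/-- For a regular `f ∈ F_op` with Morozova-Chentsov function `c` and a positive definite
bipartite density matrix `ρ`, one has `I^c_ρ(A ⊗ 1₂) ≥ I^c_{ρ₁}(A)`. -/
theorem Ic_kron_one_ge {n m : ℕ} (f : ℝ → ℝ)
    (hf_mono : OperatorMonotone f) (hf_pos : ∀ t > 0, 0 < f t)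
    (hf_symm : ∀ t > 0, f t = t * f (1 / t)) (hf_one : f 1 = 1)
    (hf_reg : 0 < f 0)
    (hf_cont : Filter.Tendsto f (nhdsWithin 0 (Set.Ioi 0)) (nhds (f 0)))
    (ρ : Matrix (Fin n × Fin m) (Fin n × Fin m) ℂ) (hρ : ρ.PosDef) (hρtr : ρ.trace = 1)
    (A : Matrix (Fin n) (Fin n) ℂ) (hA : A.IsHermitian) :
    Ic f (ptrace2 ρ) A ≤ Ic f ρ (A ⊗ₖ (1 : Matrix (Fin m) (Fin m) ℂ)) := by
  obtain ⟨⟨-, j₀⟩⟩ : Nonempty (Fin n × Fin m) := by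
    by_contra h
    rw [not_nonempty_iff] at h
    simp [trace] at hρtr
  have : Nonempty (Fin m) := ⟨j₀⟩
  have hρ₁ := posDef_ptrace2 hρ
  have hU := eigenvectorUnitary_mul_conj hρ.1
  have hW := eigenvectorUnitary_conj_mul hρ₁.1
  have hpt := isHermitian_spectral hρ₁.1
  nth_rewrite 1 [isHermitian_spectral hρ.1] at hpt
  have key := hf_mono.sum_chat_le hf_pos hf_symm
    (ampliation (hρ.1.eigenvectorUnitary : Matrix (Fin n × Fin m) (Fin n × Fin m) ℂ)
      (hρ₁.1.eigenvectorUnitary : Matrix (Fin n) (Fin n) ℂ))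
    hρ.eigenvalues_pos hρ₁.eigenvalues_pos
    (fun X Y => by
      rw [sum_star_mul_mul_right, sum_star_mul_mul_right, ampliation_conjTranspose,
        ampliation_mul hU hW, trace_ampliation_mul hW hpt])
    (fun X Y => by
      rw [sum_star_mul_mul_left, sum_star_mul_mul_left, ampliation_conjTranspose,
        ampliation_mul hU hW, trace_ampliation_mul hW hpt])
    ((hρ₁.1.eigenvectorUnitary : Matrix (Fin n) (Fin n) ℂ)ᴴ * A *
      (hρ₁.1.eigenvectorUnitary : Matrix (Fin n) (Fin n) ℂ))
  have hA' : (hρ₁.1.eigenvectorUnitary : Matrix (Fin n) (Fin n) ℂ) *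
      ((hρ₁.1.eigenvectorUnitary : Matrix (Fin n) (Fin n) ℂ)ᴴ * A *
      (hρ₁.1.eigenvectorUnitary : Matrix (Fin n) (Fin n) ℂ)) *
      (hρ₁.1.eigenvectorUnitary : Matrix (Fin n) (Fin n) ℂ)ᴴ = A := by
    have hW' := eigenvectorUnitary_mul_conj hρ₁.1
    simp only [Matrix.mul_assoc, hW', Matrix.mul_one]
    rw [← Matrix.mul_assoc, hW', Matrix.one_mul]
  rw [ampliation_apply, hA'] at key
  rw [Ic, Ic, skewSum_eq f hρ₁.1, skewSum_eq f hρ.1]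
  exact mul_le_mul_of_nonneg_left key (by positivity)
end
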